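/- Define ω_x = (η_x − ϱ_x)/(ϱ_x(K − ϱ_x)), b_N(x, x+e_i) = K[p_i ϱ_x (K − ϱ_{x+e_i}) − p_{i+d} ϱ_{x+e_i} (K − ϱ_x)], a^N_{i,x} = N^{1+κ} b_N(x, x+e_i)(ϱ_{x+e_i} − ϱ_x), and R_{N,t} = ∫ Σ_{i=1}^d Σ_{x ∈ 𝕋_N^d} a^N_{i,x} ω_x ω_{x+e_i} dμ_{N,t}. Let g_d(ℓ) = ℓ for d = 1, g_d(ℓ) = log ℓ for d = 2, and g_d(ℓ) = 1 for d ≥ 3. Then there exists a constant C, independent of N, ℓ and t ∈ [0,T], such that for all sufficiently large N and all integers ℓ ≥ 1 with 6ℓ ≤ N, R_{N,t} ≤ N^{1+κ} D_N(f_{N,t}; ν_{N,t}) + C [N^{κ−α} + N^{κ−2α−1} ℓ^d g_d(ℓ)] [H_N(t) + N^d/ℓ^d] + C [H_N(t) + N^{d+2κ−4α−2} ℓ^d g_d(ℓ)]. -/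

import Mathlib

open Real Filter

noncomputable section

/-- The discrete torus `𝕋_N^d`, realized as `d`-tuples of residues mod `N`. -/
abbrev Site (N d : ℕ) := Fin d → Fin N

/-- Configurations of the generalized exclusion process: at most `K` particles per site. -/
abbrev GCfg (N d K : ℕ) := Site N d → Fin (K + 1)

/-- Cyclic successor on `Fin N`. -/
def finCycAdd {N : ℕ} (a : Fin N) : Fin N :=
  ⟨(a.val + 1) % N, Nat.mod_lt _ (Nat.lt_of_le_of_lt (Nat.zero_le _) a.isLt)⟩

/-- Cyclic predecessor on `Fin N`. -/
def finCycSub {N : ℕ} (a : Fin N) : Fin N :=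
  ⟨(a.val + (N - 1)) % N, Nat.mod_lt _ (Nat.lt_of_le_of_lt (Nat.zero_le _) a.isLt)⟩

/-- The neighbour `x + e_i` (if `b = true`) resp. `x − e_i` (if `b = false`) of a site. -/
def siteMove {N d : ℕ} (x : Site N d) (i : Fin d) (b : Bool) : Site N d :=
  Function.update x i (if b then finCycAdd (x i) else finCycSub (x i))

/-- The configuration `η^{x,y}` obtained from `η` when one particle jumps from `x` to `y`. -/
def cfgJump {N d K : ℕ} (η : GCfg N d K) (x y : Site N d) : GCfg N d K := fun z =>
  if z = x then ⟨(η x).val - 1, lt_of_le_of_lt (Nat.sub_le _ _) (η x).isLt⟩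
  else if z = y then ⟨min ((η y).val + 1) K, Nat.lt_succ_of_le (min_le_right _ _)⟩
  else η z

/-- The jump rate `c_{x,i}(η) = p_i η_x (K − η_{x+e_i})`, with directions indexed by
`(i,b) ∈ Fin d × Bool`: `(i,true)` is `e_i` and `(i,false)` is `−e_i = e_{i+d}`. -/
def jumpRate {N d K : ℕ} (p : Fin d → Bool → ℝ) (η : GCfg N d K)
    (x : Site N d) (i : Fin d) (b : Bool) : ℝ :=
  p i b * ((η x).val : ℝ) * ((K : ℝ) - ((η (siteMove x i b)).val : ℝ))

/-- The generator `L_N` of the asymmetric generalized exclusion process. -/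
def genL {N d K : ℕ} (p : Fin d → Bool → ℝ) (f : GCfg N d K → ℝ) (η : GCfg N d K) : ℝ :=
  ∑ i : Fin d, ∑ b : Bool, ∑ x : Site N d,
    jumpRate p η x i b * (f (cfgJump η x (siteMove x i b)) - f η)

/-- The `Binomial (K, ϱ/K)` weight of the occupation number `k`. -/
def binomW (K : ℕ) (ϱ : ℝ) (k : ℕ) : ℝ :=
  (K.choose k : ℝ) * (ϱ / K) ^ k * (1 - ϱ / K) ^ (K - k)

/-- The product measure on configurations with `Binomial (K, ϱ_x/K)` marginals. -/
def prodBinom {N d K : ℕ} (ϱ : Site N d → ℝ) (η : GCfg N d K) : ℝ :=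
  ∏ x : Site N d, binomW K (ϱ x) (η x).val

/-- The relative entropy `H(μ|ν) = Σ_η f(η) log f(η) ν(η)` with `f = μ/ν`. -/
def relEnt {Ω : Type*} [Fintype Ω] (μ ν : Ω → ℝ) : ℝ :=
  ∑ η : Ω, (μ η / ν η) * Real.log (μ η / ν η) * ν η

/-- The Dirichlet form `D_N(f;ν)`. -/
def dirichletForm {N d K : ℕ} (p : Fin d → Bool → ℝ) (f ν : GCfg N d K → ℝ) : ℝ :=
  ∑ i : Fin d, ∑ b : Bool, ∑ x : Site N d, ∑ η : GCfg N d K,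
    jumpRate p η x i b *
      (Real.sqrt (f (cfgJump η x (siteMove x i b))) - Real.sqrt (f η)) ^ 2 * ν η

/-- The macroscopic coordinates `x/N ∈ 𝕋^d` of a site. -/
def siteCoord {N d : ℕ} (x : Site N d) : Fin d → ℝ := fun j => (x j : ℝ) / N

/-- The slowly varying density profile
`ϱ_N(t,u) = ϱ* + N^{−α} ρ(N^{κ−α} t, u − N^κ λ t m)`, with `λ = K − 2ϱ*`. -/
def profileGE (d K : ℕ) (ϱs α κ : ℝ) (m : Fin d → ℝ) (ρ : ℝ → (Fin d → ℝ) → ℝ)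
    (N : ℕ) (t : ℝ) (u : Fin d → ℝ) : ℝ :=
  ϱs + (N : ℝ) ^ (-α) * ρ ((N : ℝ) ^ (κ - α) * t)
    (fun j => u j - (N : ℝ) ^ κ * ((K : ℝ) - 2 * ϱs) * t * m j)

end


theorem sum_mul_le_relEnt_add_log {Ω : Type*} [Fintype Ω] (μ ν X : Ω → ℝ)
    (hμ : ∀ η, 0 ≤ μ η) (hμ1 : ∑ η, μ η = 1) (hν : ∀ η, 0 < ν η) :
    ∑ η, X η * μ η ≤ relEnt μ ν + Real.log (∑ η, Real.exp (X η) * ν η) := by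
  have : Nonempty Ω := by
    by_contra h
    rw [not_nonempty_iff] at h
    simp at hμ1
  set Z := ∑ η, Real.exp (X η) * ν η with hZ
  have hZpos : 0 < Z :=
    Finset.sum_pos (fun η _ => mul_pos (Real.exp_pos _) (hν η)) Finset.univ_nonempty
  have key : ∀ η, X η * μ η - (μ η / ν η) * Real.log (μ η / ν η) * ν η - μ η * Real.log Z
      ≤ Real.exp (X η) * ν η / Z - μ η := by
    intro η
    rcases (hμ η).eq_or_lt with h | h
    · rw [← h]
      have := div_nonneg (mul_pos (Real.exp_pos (X η)) (hν η)).le hZpos.le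
      simpa using this
    · have h1 := Real.log_le_sub_one_of_pos
        (div_pos (mul_pos (Real.exp_pos (X η)) (hν η)) (mul_pos hZpos h))
      rw [Real.log_div (mul_pos (Real.exp_pos _) (hν η)).ne' (mul_pos hZpos h).ne',
        Real.log_mul (Real.exp_pos _).ne' (hν η).ne', Real.log_mul hZpos.ne' h.ne',
        Real.log_exp] at h1
      have h2 := mul_le_mul_of_nonneg_left h1 h.le
      rw [Real.log_div h.ne' (hν η).ne']
      have e1 : μ η * (Real.exp (X η) * ν η / (Z * μ η) - 1)
          = Real.exp (X η) * ν η / Z - μ η := by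
        field_simp
      rw [e1] at h2
      have e2 : μ η / ν η * (Real.log (μ η) - Real.log (ν η)) * ν η
          = μ η * (Real.log (μ η) - Real.log (ν η)) := by
        have := (hν η).ne'
        field_simp
      rw [e2]
      linarith
  have h := Finset.sum_le_sum fun η (_ : η ∈ Finset.univ) => key η
  simp only [Finset.sum_sub_distrib, ← Finset.sum_mul, ← Finset.sum_div, hμ1, ← hZ] at h
  rw [div_self hZpos.ne'] at h
  unfold relEnt
  linarith

theorem relEnt_nonneg {Ω : Type*} [Fintype Ω] (μ ν : Ω → ℝ)
    (hμ : ∀ η, 0 ≤ μ η) (hμ1 : ∑ η, μ η = 1) (hν : ∀ η, 0 < ν η) (hν1 : ∑ η, ν η = 1) :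
    0 ≤ relEnt μ ν := by
  have := sum_mul_le_relEnt_add_log μ ν (fun _ => 0) hμ hμ1 hν
  simpa [hν1] using this

theorem exp_mul_le_cosh_add {c s x : ℝ} (hc : 0 < c) (hx : |x| ≤ c) :
    Real.exp (s * x) ≤ Real.cosh (s * c) + x * (Real.sinh (s * c) / c) := by
  rw [abs_le] at hx
  have h := (@convexOn_exp).2 (Set.mem_univ (s * c)) (Set.mem_univ (-(s * c)))
    (show 0 ≤ (1 + x / c) / 2 by
      have : -1 ≤ x / c := by rw [le_div_iff₀ hc]; linarith
      linarith)
    (show 0 ≤ (1 - x / c) / 2 by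
      have : x / c ≤ 1 := by rw [div_le_iff₀ hc]; linarith
      linarith)
    (by ring)
  have e : ((1 + x / c) / 2) • (s * c) + ((1 - x / c) / 2) • -(s * c) = s * x := by
    simp only [smul_eq_mul]; field_simp; ring
  rw [e] at h
  refine h.trans (le_of_eq ?_)
  rw [Real.cosh_eq, Real.sinh_eq]
  simp only [smul_eq_mul]; field_simp; ring

theorem sum_exp_mul_le {α : Type*} [Fintype α] {w X : α → ℝ} {c : ℝ} (hc : 0 < c)
    (hw : ∀ k, 0 ≤ w k) (hw1 : ∑ k, w k = 1) (hX0 : ∑ k, X k * w k = 0)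
    (hX : ∀ k, |X k| ≤ c) (s : ℝ) :
    ∑ k, Real.exp (s * X k) * w k ≤ Real.exp (c ^ 2 * s ^ 2 / 2) := by
  calc ∑ k, Real.exp (s * X k) * w k
      ≤ ∑ k, (Real.cosh (s * c) * w k + (X k * w k) * (Real.sinh (s * c) / c)) := by
        refine Finset.sum_le_sum fun k _ => ?_
        have := mul_le_mul_of_nonneg_right (exp_mul_le_cosh_add (s := s) hc (hX k)) (hw k)
        linarith
    _ = Real.cosh (s * c) := by
        rw [Finset.sum_add_distrib, ← Finset.mul_sum, ← Finset.sum_mul, hw1, hX0]; ring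
    _ ≤ _ := by
        refine (Real.cosh_le_exp_half_sq _).trans (le_of_eq ?_)
        ring_nf

theorem sum_exp_quadratic_fin_le {α : Type*} [Fintype α] {c M : ℝ} (hc : 0 < c) (hM : 0 ≤ M) :
    ∀ (n : ℕ) (w X : Fin n → α → ℝ), (∀ x k, 0 ≤ w x k) → (∀ x, ∑ k, w x k = 1) →
      (∀ x, ∑ k, X x k * w x k = 0) → (∀ x k, |X x k| ≤ c) →
      ∀ Q : Fin n → Fin n → ℝ, (∀ x y, Q x y = Q y x) →
      (∀ x, 4 * c ^ 2 * ∑ y, |Q x y| ≤ 1) →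
      (∀ x y, |Q x y| + 4 * c ^ 2 * M * ∑ y', |Q x y'| ≤ M) →
      ∑ η : Fin n → α, Real.exp (∑ x, ∑ y, Q x y * (X x (η x) * X y (η y))) * ∏ x, w x (η x)
        ≤ Real.exp (c ^ 2 * M * n) := by
  intro n
  induction n with
  | zero => intros; simp
  | succ n ih =>
    intro w X hw hw1 hX0 hX Q hsymm hrow hent
    have hQM : ∀ x y, |Q x y| ≤ M := fun x y => by
      have := hent x y
      have h2 : 0 ≤ 4 * c ^ 2 * M * ∑ y', |Q x y'| := by positivity
      linarith
    rw [← (Fin.consEquiv fun _ => α).sum_comp, Fintype.sum_prod_type_right]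
    set Q' : Fin n → Fin n → ℝ := fun x y =>
      Q x.succ y.succ + 2 * c ^ 2 * (Q 0 x.succ * Q 0 y.succ) with hQ'
    have hrow' : ∀ x, ∑ y, |Q' x y| ≤ (∑ y, |Q x.succ y|) - |Q 0 x.succ| / 2 := by
      intro x
      have h0 := hrow 0
      rw [Fin.sum_univ_succ] at h0
      have h1 : ∑ y, |Q' x y| ≤ ∑ y : Fin n, |Q x.succ y.succ|
          + 2 * c ^ 2 * |Q 0 x.succ| * ∑ y : Fin n, |Q 0 y.succ| := by
        rw [Finset.mul_sum, ← Finset.sum_add_distrib]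
        refine Finset.sum_le_sum fun y _ => (abs_add_le _ _).trans (le_of_eq ?_)
        rw [abs_mul (2 * c ^ 2), abs_of_nonneg (by positivity : 0 ≤ 2 * c ^ 2), abs_mul]; ring
      rw [Fin.sum_univ_succ (fun y => |Q x.succ y|), hsymm x.succ 0]
      have h2 : 4 * c ^ 2 * ∑ y : Fin n, |Q 0 y.succ| ≤ 1 := by
        have : 0 ≤ 4 * c ^ 2 * |Q 0 0| := by positivity
        linarith
      have h3 := mul_le_mul_of_nonneg_left h2 (abs_nonneg (Q 0 x.succ))
      linarith
    have step : ∀ η : Fin n → α,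
        ∑ k, Real.exp (∑ x, ∑ y, Q x y *
            (X x (Fin.consEquiv (fun _ => α) (k, η) x) * X y (Fin.consEquiv (fun _ => α) (k, η) y)))
          * ∏ x, w x (Fin.consEquiv (fun _ => α) (k, η) x)
        ≤ Real.exp (c ^ 2 * M) *
          (Real.exp (∑ x, ∑ y, Q' x y * (X x.succ (η x) * X y.succ (η y)))
            * ∏ x : Fin n, w x.succ (η x)) := by
      intro η
      set L := ∑ y : Fin n, Q 0 y.succ * X y.succ (η y) with hL
      set S := ∑ x : Fin n, ∑ y : Fin n, Q x.succ y.succ * (X x.succ (η x) * X y.succ (η y)) with hS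
      have hexp : ∀ k, ∑ x, ∑ y, Q x y *
            (X x (Fin.consEquiv (fun _ => α) (k, η) x) * X y (Fin.consEquiv (fun _ => α) (k, η) y))
          = Q 0 0 * (X 0 k) ^ 2 + 2 * L * X 0 k + S := by
        intro k
        simp only [Fin.consEquiv_apply, Fin.sum_univ_succ, Fin.cons_zero, Fin.cons_succ,
          Finset.sum_add_distrib]
        have e1 : ∑ y : Fin n, Q 0 y.succ * (X 0 k * X y.succ (η y)) = L * X 0 k := by
          rw [hL, Finset.sum_mul]; exact Finset.sum_congr rfl fun y _ => by ring
        have e2 : ∑ x : Fin n, Q x.succ 0 * (X x.succ (η x) * X 0 k) = L * X 0 k := by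
          rw [hL, Finset.sum_mul]
          exact Finset.sum_congr rfl fun y _ => by rw [hsymm y.succ 0]; ring
        rw [e1, e2]; ring
      have hS' : ∑ x, ∑ y, Q' x y * (X x.succ (η x) * X y.succ (η y)) = S + 2 * c ^ 2 * L ^ 2 := by
        have : L ^ 2 = ∑ x : Fin n, ∑ y : Fin n,
            (Q 0 x.succ * X x.succ (η x)) * (Q 0 y.succ * X y.succ (η y)) := by
          rw [sq, hL, Finset.sum_mul_sum]
        rw [this, hS, Finset.mul_sum, ← Finset.sum_add_distrib]
        refine Finset.sum_congr rfl fun x _ => ?_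
        rw [Finset.mul_sum, ← Finset.sum_add_distrib]
        refine Finset.sum_congr rfl fun y _ => ?_
        simp only [hQ']; ring
      have hP : 0 ≤ ∏ x : Fin n, w x.succ (η x) := Finset.prod_nonneg fun x _ => hw _ _
      calc _ = ∑ k, Real.exp (Q 0 0 * (X 0 k) ^ 2 + 2 * L * X 0 k + S)
              * (w 0 k * ∏ x : Fin n, w x.succ (η x)) := by
            refine Finset.sum_congr rfl fun k _ => ?_
            rw [hexp k, Fin.prod_univ_succ]
            simp
        _ ≤ ∑ k, Real.exp (c ^ 2 * M) * Real.exp S * (∏ x : Fin n, w x.succ (η x))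
              * (Real.exp (2 * L * X 0 k) * w 0 k) := by
            refine Finset.sum_le_sum fun k _ => ?_
            rw [Real.exp_add, Real.exp_add]
            have h1 : Real.exp (Q 0 0 * (X 0 k) ^ 2) ≤ Real.exp (c ^ 2 * M) := by
              apply Real.exp_le_exp.2
              have a1 : X 0 k ^ 2 ≤ c ^ 2 := sq_le_sq' (abs_le.1 (hX 0 k)).1 (abs_le.1 (hX 0 k)).2
              have a2 := (le_abs_self _).trans (hQM 0 0)
              nlinarith [sq_nonneg (X 0 k)]
            have h2 : 0 ≤ Real.exp (2 * L * X 0 k) * Real.exp S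
                * (w 0 k * ∏ x : Fin n, w x.succ (η x)) := by
              have := hw 0 k
              positivity
            nlinarith [mul_le_mul_of_nonneg_right h1 h2]
        _ ≤ Real.exp (c ^ 2 * M) * Real.exp S * (∏ x : Fin n, w x.succ (η x))
              * Real.exp (2 * c ^ 2 * L ^ 2) := by
            rw [← Finset.mul_sum]
            refine mul_le_mul_of_nonneg_left ?_ (by positivity)
            refine (sum_exp_mul_le hc (hw 0) (hw1 0) (hX0 0) (hX 0) (2 * L)).trans (le_of_eq ?_)
            ring_nf
        _ = _ := by rw [hS', Real.exp_add]; ring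
    refine (Finset.sum_le_sum fun η _ => step η).trans ?_
    rw [← Finset.mul_sum]
    have hrec := ih (fun x => w x.succ) (fun x => X x.succ) (fun x => hw _) (fun x => hw1 _)
      (fun x => hX0 _) (fun x => hX _) Q'
      (fun x y => by simp only [hQ']; rw [hsymm]; ring)
      (fun x => by
        have h1 := mul_le_mul_of_nonneg_left (hrow' x) (by positivity : 0 ≤ 4 * c ^ 2)
        have h2 := hrow x.succ
        have h3 : 0 ≤ 4 * c ^ 2 * (|Q 0 x.succ| / 2) := by positivity
        linarith)
      (fun x y => by
        have h1 := mul_le_mul_of_nonneg_left (hrow' x) (by positivity : 0 ≤ 4 * c ^ 2 * M)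
        have h2 := hent x.succ y.succ
        have h3 : |Q' x y| ≤ |Q x.succ y.succ| + 2 * c ^ 2 * (|Q 0 x.succ| * M) := by
          refine (abs_add_le _ _).trans ?_
          rw [abs_mul (2 * c ^ 2), abs_of_nonneg (by positivity : 0 ≤ 2 * c ^ 2), abs_mul]
          gcongr
          exact hQM _ _
        linarith)
    calc _ ≤ Real.exp (c ^ 2 * M) * Real.exp (c ^ 2 * M * n) :=
          mul_le_mul_of_nonneg_left hrec (Real.exp_pos _).le
      _ = _ := by rw [← Real.exp_add]; push_cast; ring_nf

theorem sum_exp_quadratic_le {ι α : Type*} [Fintype ι] [Fintype α] [DecidableEq ι] {c q θ : ℝ}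
    (hc : 0 < c) {w X : ι → α → ℝ} (hw : ∀ x k, 0 ≤ w x k) (hw1 : ∀ x, ∑ k, w x k = 1)
    (hX0 : ∀ x, ∑ k, X x k * w x k = 0) (hX : ∀ x k, |X x k| ≤ c) {Q : ι → ι → ℝ}
    (hq : 0 ≤ q) (hent : ∀ x y, |Q x y| ≤ q) (hrow : ∀ x, ∑ y, |Q x y| ≤ θ)
    (hcol : ∀ y, ∑ x, |Q x y| ≤ θ) (hθ : 8 * c ^ 2 * θ ≤ 1) :
    ∑ η : ι → α, Real.exp (∑ x, ∑ y, Q x y * (X x (η x) * X y (η y))) * ∏ x, w x (η x)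
      ≤ Real.exp (2 * c ^ 2 * q * Fintype.card ι) := by
  set e := Fintype.equivFin ι
  have hsum : ∀ x, ∑ y, |(Q (e.symm x) (e.symm y) + Q (e.symm y) (e.symm x)) / 2| ≤ θ := by
    intro x
    rw [e.symm.sum_comp (fun y => |(Q (e.symm x) y + Q y (e.symm x)) / 2|)]
    have : ∑ y, |(Q (e.symm x) y + Q y (e.symm x)) / 2|
        ≤ (∑ y, |Q (e.symm x) y| + ∑ y, |Q y (e.symm x)|) / 2 := by
      rw [← Finset.sum_add_distrib, Finset.sum_div]
      refine Finset.sum_le_sum fun y _ => ?_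
      rw [abs_div, abs_two]
      gcongr
      exact abs_add_le _ _
    linarith [hrow (e.symm x), hcol (e.symm x)]
  have h := sum_exp_quadratic_fin_le hc (M := 2 * q) (by positivity) (Fintype.card ι)
    (fun x => w (e.symm x)) (fun x => X (e.symm x)) (fun x => hw _) (fun x => hw1 _)
    (fun x => hX0 _) (fun x => hX _)
    (fun x y => (Q (e.symm x) (e.symm y) + Q (e.symm y) (e.symm x)) / 2)
    (fun x y => by ring)
    (fun x => by
      have h1 := mul_le_mul_of_nonneg_left (hsum x) (by positivity : 0 ≤ 4 * c ^ 2)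
      linarith)
    (fun x y => by
      have h1 := mul_le_mul_of_nonneg_left (hsum x) (by positivity : 0 ≤ 4 * c ^ 2 * (2 * q))
      have h2 : |(Q (e.symm x) (e.symm y) + Q (e.symm y) (e.symm x)) / 2| ≤ q := by
        rw [abs_div, abs_two]
        linarith [abs_add_le (Q (e.symm x) (e.symm y)) (Q (e.symm y) (e.symm x)),
          hent (e.symm x) (e.symm y), hent (e.symm y) (e.symm x)]
      nlinarith)
  rw [← (e.arrowCongr (Equiv.refl α)).sum_comp] at h
  refine le_trans (le_of_eq (Finset.sum_congr rfl fun η _ => ?_)) (h.trans (le_of_eq ?_))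
  · have hη : ∀ x, (e.arrowCongr (Equiv.refl α)) η x = η (e.symm x) := fun x => rfl
    simp only [hη]
    rw [e.symm.prod_comp (fun x => w x (η x))]
    congr 2
    rw [e.symm.sum_comp (fun x => ∑ y, (Q x (e.symm y) + Q (e.symm y) x) / 2
      * (X x (η x) * X (e.symm y) (η (e.symm y))))]
    have hinner : ∀ x, ∑ y, (Q x (e.symm y) + Q (e.symm y) x) / 2
        * (X x (η x) * X (e.symm y) (η (e.symm y)))
        = ∑ y, (Q x y + Q y x) / 2 * (X x (η x) * X y (η y)) := fun x =>
      e.symm.sum_comp (fun y => (Q x y + Q y x) / 2 * (X x (η x) * X y (η y)))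
    simp only [hinner]
    have hswap : ∑ x, ∑ y, Q y x * (X x (η x) * X y (η y))
        = ∑ x, ∑ y, Q x y * (X x (η x) * X y (η y)) := by
      rw [Finset.sum_comm]
      exact Finset.sum_congr rfl fun x _ => Finset.sum_congr rfl fun y _ => by ring
    have : ∑ x, ∑ y, (Q x y + Q y x) / 2 * (X x (η x) * X y (η y))
        = (∑ x, ∑ y, Q x y * (X x (η x) * X y (η y))
          + ∑ x, ∑ y, Q y x * (X x (η x) * X y (η y))) / 2 := by
      simp only [← Finset.sum_add_distrib, Finset.sum_div]
      exact Finset.sum_congr rfl fun x _ => Finset.sum_congr rfl fun y _ => by ring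
    rw [this, hswap]; ring
  · ring_nf

theorem sum_quadratic_mul_le {ι α : Type*} [Fintype ι] [Fintype α] [DecidableEq ι] {c q θ : ℝ}
    (hc : 0 < c) {w X : ι → α → ℝ} (hw : ∀ x k, 0 < w x k) (hw1 : ∀ x, ∑ k, w x k = 1)
    (hX0 : ∀ x, ∑ k, X x k * w x k = 0) (hX : ∀ x k, |X x k| ≤ c) {Q : ι → ι → ℝ}
    (hq : 0 ≤ q) (hent : ∀ x y, |Q x y| ≤ q) (hrow : ∀ x, ∑ y, |Q x y| ≤ θ)
    (hcol : ∀ y, ∑ x, |Q x y| ≤ θ) (hθ : 0 < θ) {μ : (ι → α) → ℝ}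
    (hμ : ∀ η, 0 ≤ μ η) (hμ1 : ∑ η, μ η = 1) :
    ∑ η, (∑ x, ∑ y, Q x y * (X x (η x) * X y (η y))) * μ η
      ≤ 8 * c ^ 2 * θ * relEnt μ (fun η => ∏ x, w x (η x)) + 2 * c ^ 2 * q * Fintype.card ι := by
  set D := 8 * c ^ 2 * θ with hD
  have hDpos : 0 < D := by positivity
  have hscale : ∀ a b : ℝ, |a / D * b| = |a * b| / D := fun a b => by
    rw [div_mul_eq_mul_div, abs_div, abs_of_pos hDpos]
  have hscale' : ∀ a : ℝ, |a / D| = |a| / D := fun a => by rw [abs_div, abs_of_pos hDpos]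
  have h1 := sum_exp_quadratic_le (q := q / D) (θ := θ / D) (Q := fun x y => Q x y / D) hc
    (fun x k => (hw x k).le) hw1 hX0 hX (by positivity)
    (fun x y => by rw [hscale']; gcongr; exact hent x y)
    (fun x => by simp only [hscale', ← Finset.sum_div]; gcongr; exact hrow x)
    (fun x => by simp only [hscale', ← Finset.sum_div]; gcongr; exact hcol x)
    (by rw [← mul_div_assoc, ← hD, div_self hDpos.ne'])
  have h2 := sum_mul_le_relEnt_add_log μ (fun η => ∏ x, w x (η x))
    (fun η => ∑ x, ∑ y, Q x y / D * (X x (η x) * X y (η y))) hμ hμ1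
    (fun η => Finset.prod_pos fun x _ => hw x _)
  have h3 : Real.log (∑ η : ι → α, Real.exp (∑ x, ∑ y, Q x y / D * (X x (η x) * X y (η y)))
      * ∏ x, w x (η x)) ≤ 2 * c ^ 2 * (q / D) * Fintype.card ι := by
    rcases le_or_gt (∑ η : ι → α, Real.exp (∑ x, ∑ y, Q x y / D * (X x (η x) * X y (η y)))
      * ∏ x, w x (η x)) 0 with hle | hlt
    · have hz : 0 ≤ ∑ η : ι → α, Real.exp (∑ x, ∑ y, Q x y / D * (X x (η x) * X y (η y)))
          * ∏ x, w x (η x) :=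
        Finset.sum_nonneg fun η _ => mul_nonneg (Real.exp_pos _).le
          (Finset.prod_nonneg fun x _ => (hw x _).le)
      rw [le_antisymm hle hz, Real.log_zero]
      positivity
    · rw [Real.log_le_iff_le_exp hlt]
      exact h1
  have h4 : ∑ η, (∑ x, ∑ y, Q x y * (X x (η x) * X y (η y))) * μ η
      = D * ∑ η, (∑ x, ∑ y, Q x y / D * (X x (η x) * X y (η y))) * μ η := by
    rw [Finset.mul_sum]
    refine Finset.sum_congr rfl fun η _ => ?_
    rw [← mul_assoc, Finset.mul_sum]
    congr 1
    refine Finset.sum_congr rfl fun x _ => ?_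
    rw [Finset.mul_sum]
    refine Finset.sum_congr rfl fun y _ => ?_
    field_simp
  rw [h4]
  have h5 := mul_le_mul_of_nonneg_left (h2.trans (add_le_add_right h3 _)) hDpos.le
  refine h5.trans (le_of_eq ?_)
  rw [mul_add]
  congr 1
  field_simp

noncomputable section

/-- The uniform probability weights on `{0, …, r - 1} ⊆ Fin N`. -/
def intervalWeight {N : ℕ} (r : ℕ) (a : Fin N) : ℝ :=
  if a.val < r then (r : ℝ)⁻¹ else 0

/-- The one-dimensional flow transporting `intervalWeight r` to `intervalWeight (r + 1)`. -/
def intervalFlow {N : ℕ} (r : ℕ) (a : Fin N) : ℝ :=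
  if a.val < r then ((a.val : ℝ) + 1) * ((r : ℝ)⁻¹ * ((r : ℝ) + 1)⁻¹) else 0

/-- The flow across edges in direction `j` which transports the uniform weights on the box of side
`r` to those on the box of side `r + 1`. -/
def boxStepFlow {N d : ℕ} (r : ℕ) (j : Fin d) (y : Site N d) : ℝ :=
  ∏ i, if i < j then intervalWeight (r + 1) (y i)
    else if i = j then intervalFlow r (y i) else intervalWeight r (y i)

/-- The flow in direction `j` which spreads a unit mass at the origin over the box of side `ℓ`. -/
def boxFlow {N d : ℕ} (ℓ : ℕ) (j : Fin d) (y : Site N d) : ℝ :=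
  ∑ r ∈ Finset.Ico 1 ℓ, boxStepFlow r j y

/-- The uniform probability weights on the box of side `ℓ`. -/
def boxWeight {N d : ℕ} (ℓ : ℕ) (y : Site N d) : ℝ := ∏ i, intervalWeight ℓ (y i)

end

theorem intervalWeight_nonneg {N : ℕ} (r : ℕ) (a : Fin N) : 0 ≤ intervalWeight r a := by
  unfold intervalWeight; split_ifs <;> positivity

theorem intervalFlow_nonneg {N : ℕ} (r : ℕ) (a : Fin N) : 0 ≤ intervalFlow r a := by
  unfold intervalFlow; split_ifs <;> positivity

theorem intervalWeight_le {N : ℕ} (r : ℕ) (a : Fin N) : intervalWeight r a ≤ (r : ℝ)⁻¹ := by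
  unfold intervalWeight; split_ifs
  · exact le_rfl
  · positivity

theorem intervalFlow_le {N : ℕ} (r : ℕ) (a : Fin N) : intervalFlow r a ≤ intervalWeight r a := by
  unfold intervalFlow intervalWeight
  split_ifs with h
  · have h1 : ((a.val : ℝ) + 1) * ((r : ℝ) + 1)⁻¹ ≤ 1 := by
      rw [← div_eq_mul_inv, div_le_one (by positivity)]
      have : (a.val : ℝ) ≤ r := by exact_mod_cast h.le
      linarith
    have h2 := mul_le_mul_of_nonneg_left h1 (by positivity : 0 ≤ (r : ℝ)⁻¹)
    linarith
  · exact le_rfl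

theorem sum_intervalWeight {N r : ℕ} (hr : 1 ≤ r) (hrN : r ≤ N) :
    ∑ a : Fin N, intervalWeight r a = 1 := by
  have : (r : ℝ) ≠ 0 := by positivity
  unfold intervalWeight
  rw [Fin.sum_univ_eq_sum_range (fun a => if a < r then (r : ℝ)⁻¹ else 0) N, ← Finset.sum_filter]
  have hf : {a ∈ Finset.range N | a < r} = Finset.range r := by
    ext a; simp only [Finset.mem_filter, Finset.mem_range]; omega
  rw [hf]
  simp [this]

theorem intervalWeight_sub_succ {N r : ℕ} [NeZero N] (hr : 1 ≤ r) (hrN : r < N) (a : Fin N) :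
    intervalWeight r a - intervalWeight (r + 1) a = intervalFlow r a - intervalFlow r (a - 1) := by
  obtain ⟨b, rfl⟩ : ∃ b, a = b + 1 := ⟨a - 1, by simp⟩
  rw [add_sub_cancel_right]
  have hb := b.isLt
  have h1 : ((1 : Fin N) : ℕ) = 1 := by
    rw [Fin.val_one', Nat.mod_eq_of_lt (by omega)]
  have hr0 : (r : ℝ) ≠ 0 := by positivity
  have hr1 : (r : ℝ) + 1 ≠ 0 := by positivity
  unfold intervalWeight intervalFlow
  rw [Fin.val_add, h1]
  rcases (Nat.lt_or_ge (b.val + 1) N) with h | h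
  · rw [Nat.mod_eq_of_lt h]
    rcases Nat.lt_trichotomy (b.val + 1) r with h2 | h2 | h2
    · rw [if_pos h2, if_pos (by omega), if_pos h2, if_pos (by omega)]
      push_cast
      field_simp
      ring
    · rw [if_neg (by omega), if_pos (by omega), if_neg (by omega), if_pos (by omega)]
      have : (b.val : ℝ) + 1 = r := by exact_mod_cast h2
      rw [this]
      push_cast
      field_simp
    · rw [if_neg (by omega), if_neg (by omega), if_neg (by omega), if_neg (by omega)]
  · have : b.val + 1 = N := by omega
    rw [this, Nat.mod_self, if_pos (by omega), if_pos (by omega), if_pos (by omega),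
      if_neg (by omega)]
    push_cast
    field_simp
    ring

theorem boxStepFlow_nonneg {N d : ℕ} (r : ℕ) (j : Fin d) (y : Site N d) :
    0 ≤ boxStepFlow r j y := by
  refine Finset.prod_nonneg fun i _ => ?_
  split_ifs
  exacts [intervalWeight_nonneg _ _, intervalFlow_nonneg _ _, intervalWeight_nonneg _ _]

theorem boxStepFlow_le {N d r : ℕ} (hr : 1 ≤ r) (j : Fin d) (y : Site N d) :
    boxStepFlow r j y ≤ ((r : ℝ)⁻¹) ^ d := by
  have h : ∀ i ∈ Finset.univ, (if i < j then intervalWeight (r + 1) (y i)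
    else if i = j then intervalFlow r (y i) else intervalWeight r (y i)) ≤ (r : ℝ)⁻¹ := by
    intro i _
    split_ifs
    · refine (intervalWeight_le _ _).trans ?_
      have : (0 : ℝ) < r := by positivity
      push_cast
      gcongr
      linarith
    · exact (intervalFlow_le _ _).trans (intervalWeight_le _ _)
    · exact intervalWeight_le _ _
  refine (Finset.prod_le_prod (fun i _ => ?_) h).trans (by simp)
  split_ifs
  exacts [intervalWeight_nonneg _ _, intervalFlow_nonneg _ _, intervalWeight_nonneg _ _]

theorem sum_boxStepFlow_le {N d r : ℕ} (hr : 1 ≤ r) (hrN : r < N) (j : Fin d) :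
    ∑ y : Site N d, boxStepFlow r j y ≤ 1 := by
  have h := Finset.prod_univ_sum (fun _ : Fin d => (Finset.univ : Finset (Fin N)))
    (fun i a => if i < j then intervalWeight (r + 1) a
      else if i = j then intervalFlow r a else intervalWeight r a)
  rw [Fintype.piFinset_univ] at h
  unfold boxStepFlow
  rw [← h]
  refine Finset.prod_le_one (fun i _ => Finset.sum_nonneg fun a _ => ?_) (fun i _ => ?_)
  · split_ifs
    exacts [intervalWeight_nonneg _ _, intervalFlow_nonneg _ _, intervalWeight_nonneg _ _]
  · split_ifs
    · exact (sum_intervalWeight (by omega) (by omega)).le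
    · exact (Finset.sum_le_sum fun a _ => intervalFlow_le _ _).trans
        (sum_intervalWeight hr hrN.le).le
    · exact (sum_intervalWeight hr hrN.le).le

theorem boxWeight_sub_succ {N d r : ℕ} [NeZero N] (hr : 1 ≤ r) (hrN : r < N) (y : Site N d) :
    boxWeight r y - boxWeight (r + 1) y
      = ∑ j, (boxStepFlow r j y - boxStepFlow r j (y - Pi.single j 1)) := by
  have h := Finset.prod_sub_ordered (Finset.univ : Finset (Fin d))
    (fun i => intervalWeight r (y i))
    (fun i => intervalWeight r (y i) - intervalWeight (r + 1) (y i))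
  simp only [sub_sub_cancel] at h
  unfold boxWeight
  rw [h, sub_sub_cancel]
  refine Finset.sum_congr rfl fun j _ => ?_
  have key : ∀ z : Site N d, boxStepFlow r j z = intervalFlow r (z j)
      * (∏ i with i < j, intervalWeight (r + 1) (z i)) * ∏ i with j < i, intervalWeight r (z i) := by
    intro z
    unfold boxStepFlow
    rw [Finset.prod_ite, mul_assoc, mul_left_comm]
    congr 1
    rw [Finset.prod_ite]
    congr 1
    · rw [Finset.prod_eq_single j]
      · intro b hb hbj
        simp only [Finset.mem_filter] at hb
        exact absurd hb.2 hbj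
      · intro hj; simp at hj
    · refine Finset.prod_congr ?_ fun _ _ => rfl
      ext i
      simp only [Finset.mem_filter, Finset.mem_univ, true_and, not_lt]
      exact ⟨fun hi => lt_of_le_of_ne hi.1 (Ne.symm hi.2), fun hi => ⟨hi.le, hi.ne'⟩⟩
  rw [key y, key (y - Pi.single j 1)]
  have e1 : ∏ i with i < j, intervalWeight (r + 1) ((y - Pi.single j 1 : Site N d) i)
      = ∏ i with i < j, intervalWeight (r + 1) (y i) := by
    refine Finset.prod_congr rfl fun i hi => ?_
    simp only [Finset.mem_filter] at hi
    simp [hi.2.ne]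
  have e2 : ∏ i with j < i, intervalWeight r ((y - Pi.single j 1 : Site N d) i)
      = ∏ i with j < i, intervalWeight r (y i) := by
    refine Finset.prod_congr rfl fun i hi => ?_
    simp only [Finset.mem_filter] at hi
    simp [hi.2.ne']
  rw [e1, e2, intervalWeight_sub_succ hr hrN]
  simp only [Pi.sub_apply, Pi.single_eq_same]
  ring

theorem boxWeight_one {N d : ℕ} [NeZero N] (y : Site N d) :
    boxWeight 1 y = if y = 0 then 1 else 0 := by
  unfold boxWeight intervalWeight
  split_ifs with h
  · subst h; simp
  · obtain ⟨i, hi⟩ := Function.ne_iff.1 h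
    refine Finset.prod_eq_zero (Finset.mem_univ i) (if_neg ?_)
    intro h0
    exact hi (Fin.ext (by simpa using h0))

theorem sum_boxFlow_sub {N d ℓ : ℕ} [NeZero N] (hℓ : 1 ≤ ℓ) (hℓN : ℓ ≤ N) (y : Site N d) :
    ∑ j, (boxFlow ℓ j y - boxFlow ℓ j (y - Pi.single j 1))
      = (if y = 0 then 1 else 0) - boxWeight ℓ y := by
  unfold boxFlow
  simp only [← Finset.sum_sub_distrib]
  rw [Finset.sum_comm, ← boxWeight_one]
  have : ∀ r ∈ Finset.Ico 1 ℓ,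
      ∑ j, (boxStepFlow r j y - boxStepFlow r j (y - Pi.single j 1))
        = -(boxWeight (r + 1) y - boxWeight r y) := fun r hr => by
    rw [Finset.mem_Ico] at hr
    rw [← boxWeight_sub_succ hr.1 (by omega)]; ring
  rw [Finset.sum_congr rfl this, Finset.sum_neg_distrib,
    Finset.sum_Ico_sub (fun r => boxWeight r y) hℓ]
  ring

theorem boxFlow_nonneg {N d : ℕ} (ℓ : ℕ) (j : Fin d) (y : Site N d) : 0 ≤ boxFlow ℓ j y :=
  Finset.sum_nonneg fun r _ => boxStepFlow_nonneg r j y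

theorem boxFlow_eq_zero {N d ℓ : ℕ} (j : Fin d) {y : Site N d} {i : Fin d}
    (hi : ℓ ≤ (y i).val) : boxFlow ℓ j y = 0 := by
  refine Finset.sum_eq_zero fun r hr => Finset.prod_eq_zero (Finset.mem_univ i) ?_
  rw [Finset.mem_Ico] at hr
  unfold intervalWeight intervalFlow
  split_ifs <;> first | rfl | omega

theorem sum_boxFlow_le {N d ℓ : ℕ} (hℓN : ℓ ≤ N) (j : Fin d) :
    ∑ y : Site N d, boxFlow ℓ j y ≤ (ℓ - 1 : ℕ) := by
  unfold boxFlow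
  rw [Finset.sum_comm]
  calc _ ≤ ∑ r ∈ Finset.Ico 1 ℓ, (1 : ℝ) := Finset.sum_le_sum fun r hr => by
        rw [Finset.mem_Ico] at hr
        exact sum_boxStepFlow_le hr.1 (by omega) j
    _ ≤ (ℓ - 1 : ℕ) := by
        simp

theorem sum_boxFlow_sq_le {N d ℓ : ℕ} (hℓ : 1 ≤ ℓ) (hℓN : ℓ ≤ N) (j : Fin d) :
    ∑ y : Site N d, boxFlow ℓ j y ^ 2 ≤ 2 * ∑ r ∈ Finset.Ico 1 ℓ, (r : ℝ) * ((r : ℝ)⁻¹) ^ d := by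
  induction ℓ, hℓ using Nat.le_induction with
  | base => simp [boxFlow]
  | succ r hr ih =>
    have hsucc : ∀ y : Site N d, boxFlow (r + 1) j y = boxFlow r j y + boxStepFlow r j y :=
      fun y => Finset.sum_Ico_succ_top hr _
    have hb : ∀ y : Site N d, boxFlow (r + 1) j y ^ 2 ≤ boxFlow r j y ^ 2
        + (boxFlow (r + 1) j y + boxFlow r j y) * ((r : ℝ)⁻¹) ^ d := by
      intro y
      have h1 : 0 ≤ boxFlow (r + 1) j y + boxFlow r j y :=
        add_nonneg (boxFlow_nonneg _ _ _) (boxFlow_nonneg _ _ _)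
      have h2 := mul_le_mul_of_nonneg_left (boxStepFlow_le hr j y) h1
      have h3 := hsucc y
      have h4 : boxFlow (r + 1) j y ^ 2 - boxFlow r j y ^ 2
          = (boxFlow (r + 1) j y + boxFlow r j y) * boxStepFlow r j y := by
        rw [h3]; ring
      linarith
    have h0 : (0 : ℝ) ≤ ((r : ℝ)⁻¹) ^ d := by positivity
    have h5 : ∑ y : Site N d, (boxFlow (r + 1) j y + boxFlow r j y) ≤ 2 * r := by
      have h6 : ∑ y : Site N d, (boxFlow (r + 1) j y + boxFlow r j y)
          = 2 * ∑ y : Site N d, boxFlow r j y + ∑ y : Site N d, boxStepFlow r j y := by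
        rw [Finset.mul_sum, ← Finset.sum_add_distrib]
        exact Finset.sum_congr rfl fun y _ => by rw [hsucc y]; ring
      have h7 := sum_boxFlow_le (N := N) (d := d) (ℓ := r) (by omega) j
      have h8 := sum_boxStepFlow_le (N := N) (d := d) hr (by omega) j
      rw [Nat.cast_sub hr] at h7
      push_cast at h7
      linarith
    rw [Finset.sum_Ico_succ_top hr, mul_add]
    refine (Finset.sum_le_sum fun y _ => hb y).trans ?_
    rw [Finset.sum_add_distrib, ← Finset.sum_mul]
    have := mul_le_mul_of_nonneg_right h5 h0
    have := ih (by omega)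
    linarith

theorem boxWeight_nonneg {N d : ℕ} (ℓ : ℕ) (y : Site N d) : 0 ≤ boxWeight ℓ y :=
  Finset.prod_nonneg fun _ _ => intervalWeight_nonneg _ _

theorem boxWeight_le {N d : ℕ} (ℓ : ℕ) (y : Site N d) : boxWeight ℓ y ≤ ((ℓ : ℝ)⁻¹) ^ d :=
  (Finset.prod_le_prod (fun _ _ => intervalWeight_nonneg _ _)
    fun _ _ => intervalWeight_le _ _).trans (by simp)

theorem sum_boxWeight {N d ℓ : ℕ} (hℓ : 1 ≤ ℓ) (hℓN : ℓ ≤ N) :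
    ∑ y : Site N d, boxWeight ℓ y = 1 := by
  have h := Finset.prod_univ_sum (fun _ : Fin d => (Finset.univ : Finset (Fin N)))
    (fun _ a => intervalWeight ℓ a)
  rw [Fintype.piFinset_univ] at h
  unfold boxWeight
  rw [← h]
  simp [sum_intervalWeight hℓ hℓN]

theorem siteMove_true {N d : ℕ} [NeZero N] (x : Site N d) (i : Fin d) :
    siteMove x i true = x + Pi.single i 1 := by
  funext j
  unfold siteMove finCycAdd
  by_cases h : j = i
  · subst h
    refine Fin.ext ?_
    simp [Fin.val_add]
  · simp [h]

theorem siteMove_add_false {N d : ℕ} [NeZero N] (x : Site N d) (i : Fin d) :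
    siteMove (x + Pi.single i 1) i false = x := by
  rw [← siteMove_true]
  funext j
  unfold siteMove finCycAdd finCycSub
  by_cases h : j = i
  · subst h
    refine Fin.ext ?_
    have h1 := (x j).isLt
    simp only [Bool.false_eq_true, if_false, if_true, Function.update_self]
    rcases Nat.lt_or_ge ((x j).val + 1) N with h2 | h2
    · rw [Nat.mod_eq_of_lt h2, show (x j).val + 1 + (N - 1) = (x j).val + N by omega,
        Nat.add_mod_right, Nat.mod_eq_of_lt h1]
    · have h3 : (x j).val + 1 = N := by omega
      rw [h3, Nat.mod_self, Nat.mod_eq_of_lt (by omega)]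
      omega
  · simp [h]

theorem binomW_succ {K k : ℕ} (hK : 1 ≤ K) (hk : k < K) (ϱ : ℝ) :
    ((k : ℝ) + 1) * binomW K ϱ (k + 1) * ((K : ℝ) - ϱ) = ϱ * ((K : ℝ) - k) * binomW K ϱ k := by
  have hK0 : (K : ℝ) ≠ 0 := by positivity
  have h1 : (K.choose (k + 1) : ℝ) * ((k : ℝ) + 1) = K.choose k * ((K : ℝ) - k) := by
    have := Nat.choose_succ_right_eq K k
    rw [← Nat.cast_sub hk.le]
    exact_mod_cast this
  obtain ⟨m, rfl⟩ : ∃ m, K = k + 1 + m := ⟨K - (k + 1), by omega⟩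
  unfold binomW
  rw [show k + 1 + m - (k + 1) = m by omega, show k + 1 + m - k = m + 1 by omega,
    pow_succ _ k, pow_succ _ m]
  generalize hc : ((k + 1 + m : ℕ) : ℝ) = L at *
  have e : ϱ / L * (L - ϱ) = ϱ * (1 - ϱ / L) := by field_simp
  linear_combination ((ϱ / L) ^ k * (1 - ϱ / L) ^ m * (ϱ * (1 - ϱ / L))) * h1
    + (k + 1) * ((k + 1 + m).choose (k + 1) : ℝ) * (ϱ / L) ^ k * (1 - ϱ / L) ^ m * e

theorem sum_binomW (K : ℕ) (ϱ : ℝ) : ∑ k : Fin (K + 1), binomW K ϱ k.val = 1 := by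
  rw [Fin.sum_univ_eq_sum_range (fun k => binomW K ϱ k)]
  have h := add_pow (ϱ / K) (1 - ϱ / K) K
  rw [add_sub_cancel, one_pow] at h
  rw [h]
  exact Finset.sum_congr rfl fun k _ => by unfold binomW; ring

theorem sum_mul_binomW {K : ℕ} (hK : 1 ≤ K) (ϱ : ℝ) :
    ∑ k : Fin (K + 1), (k.val : ℝ) * binomW K ϱ k.val = ϱ := by
  have h1 := sum_binomW K ϱ
  have h2 : (∑ k : Fin (K + 1), (k.val : ℝ) * binomW K ϱ k.val) * ((K : ℝ) - ϱ)
      = ∑ k : Fin (K + 1), ϱ * ((K : ℝ) - k.val) * binomW K ϱ k.val := by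
    rw [Fin.sum_univ_succ, Fin.sum_univ_castSucc (fun k : Fin (K + 1) =>
      ϱ * ((K : ℝ) - k.val) * binomW K ϱ k.val)]
    simp only [Fin.val_zero, Nat.cast_zero, zero_mul, zero_add, Fin.val_succ, Fin.val_castSucc,
      Fin.val_last, sub_self, mul_zero, add_zero]
    rw [Finset.sum_mul]
    refine Finset.sum_congr rfl fun k _ => ?_
    rw [← binomW_succ hK k.isLt]
    push_cast
    ring
  have h3 : ∑ k : Fin (K + 1), ϱ * ((K : ℝ) - k.val) * binomW K ϱ k.val
      = ϱ * K * ∑ k : Fin (K + 1), binomW K ϱ k.val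
        - ϱ * ∑ k : Fin (K + 1), (k.val : ℝ) * binomW K ϱ k.val := by
    rw [Finset.mul_sum, Finset.mul_sum, ← Finset.sum_sub_distrib]
    exact Finset.sum_congr rfl fun k _ => by ring
  rw [h1] at h3
  have hK0 : (K : ℝ) ≠ 0 := by positivity
  refine mul_right_cancel₀ hK0 ?_
  linarith

theorem binomW_pos {K : ℕ} {ϱ : ℝ} (h0 : 0 < ϱ) (h1 : ϱ < K) {k : ℕ} (hk : k ≤ K) :
    0 < binomW K ϱ k := by
  have hK : (0 : ℝ) < K := h0.trans h1
  have h2 : 0 < 1 - ϱ / K := by rw [sub_pos, div_lt_one hK]; exact h1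
  have h3 : 0 < K.choose k := Nat.choose_pos hk
  unfold binomW
  positivity

theorem cfgJump_left {N d K : ℕ} (η : GCfg N d K) (x y : Site N d) :
    (cfgJump η x y x).val = (η x).val - 1 := by
  simp [cfgJump]

theorem cfgJump_right {N d K : ℕ} (η : GCfg N d K) {x y : Site N d} (h : x ≠ y) :
    (cfgJump η x y y).val = min ((η y).val + 1) K := by
  simp [cfgJump, h.symm]

theorem cfgJump_of_ne {N d K : ℕ} (η : GCfg N d K) {x y z : Site N d} (hx : z ≠ x) (hy : z ≠ y) :
    cfgJump η x y z = η z := by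
  simp [cfgJump, hx, hy]

theorem cfgJump_cfgJump {N d K : ℕ} {η : GCfg N d K} {x y : Site N d} (h : x ≠ y)
    (hx : 0 < (η x).val) (hy : (η y).val < K) : cfgJump (cfgJump η x y) y x = η := by
  funext z
  refine Fin.ext ?_
  by_cases hzx : z = x
  · subst hzx
    rw [cfgJump_right _ h.symm, cfgJump_left]
    have := (η z).isLt
    omega
  · by_cases hzy : z = y
    · subst hzy
      rw [cfgJump_left, cfgJump_right _ h]
      omega
    · rw [cfgJump_of_ne _ hzy hzx, cfgJump_of_ne _ hzx hzy]

theorem prodBinom_cfgJump {N d K : ℕ} (hK : 1 ≤ K) (ϱ : Site N d → ℝ) {η : GCfg N d K}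
    {x y : Site N d} (h : x ≠ y) (hx : 0 < (η x).val) (hy : (η y).val < K) :
    ϱ y * (K - ϱ x) * ((η x).val * (K - (η y).val) * prodBinom ϱ η)
      = ϱ x * (K - ϱ y) * ((cfgJump η x y y).val * (K - (cfgJump η x y x).val)
        * prodBinom ϱ (cfgJump η x y)) := by
  have hsplit : ∀ ξ : GCfg N d K, prodBinom ϱ ξ = binomW K (ϱ x) (ξ x).val
      * (binomW K (ϱ y) (ξ y).val * ∏ z ∈ (Finset.univ.erase x).erase y,
        binomW K (ϱ z) (ξ z).val) := by
    intro ξ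
    unfold prodBinom
    rw [Finset.mul_prod_erase _ (fun z => binomW K (ϱ z) (ξ z).val)
        (Finset.mem_erase.2 ⟨h.symm, Finset.mem_univ y⟩),
      Finset.mul_prod_erase _ (fun z => binomW K (ϱ z) (ξ z).val) (Finset.mem_univ x)]
  have hrest : ∏ z ∈ (Finset.univ.erase x).erase y, binomW K (ϱ z) (cfgJump η x y z).val
      = ∏ z ∈ (Finset.univ.erase x).erase y, binomW K (ϱ z) (η z).val := by
    refine Finset.prod_congr rfl fun z hz => ?_
    simp only [Finset.mem_erase, Finset.mem_univ, and_true] at hz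
    rw [cfgJump_of_ne _ hz.2 hz.1]
  rw [hsplit η, hsplit (cfgJump η x y), hrest, cfgJump_left, cfgJump_right _ h,
    min_eq_left (by omega)]
  obtain ⟨a, ha⟩ : ∃ a, (η x).val = a + 1 := ⟨(η x).val - 1, by omega⟩
  have haK : a < K := by have := (η x).isLt; omega
  have h1 := binomW_succ hK haK (ϱ x)
  have h2 := binomW_succ hK hy (ϱ y)
  rw [ha, Nat.add_sub_cancel]
  push_cast
  generalize ∏ z ∈ (Finset.univ.erase x).erase y, binomW K (ϱ z) (η z).val = P
  linear_combination (ϱ y * (K - (η y).val) * binomW K (ϱ y) (η y).val * P) * h1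
    - (ϱ x * (K - a) * binomW K (ϱ x) a * P) * h2

theorem sum_comp_cfgJump {N d K : ℕ} (hK : 1 ≤ K) (ϱ : Site N d → ℝ) {x y : Site N d} (h : x ≠ y)
    (Φ : GCfg N d K → ℝ) :
    ϱ y * (K - ϱ x) * ∑ η : GCfg N d K,
        (η x).val * (K - (η y).val) * prodBinom ϱ η * Φ (cfgJump η x y)
      = ϱ x * (K - ϱ y) * ∑ η : GCfg N d K,
        (η y).val * (K - (η x).val) * prodBinom ϱ η * Φ η := by
  have hfilter : ∀ (x y : Site N d) (F : GCfg N d K → ℝ),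
      ∑ η : GCfg N d K, (η x).val * (K - (η y).val) * F η
        = ∑ η : GCfg N d K with 0 < (η x).val ∧ (η y).val < K,
          (η x).val * (K - (η y).val) * F η := by
    intro x y F
    refine (Finset.sum_filter_of_ne fun η _ hne => ?_).symm
    constructor
    · by_contra h0
      exact hne (by simp [Nat.eq_zero_of_not_pos h0])
    · by_contra h0
      have h1 : (η y).val = K := by have := (η y).isLt; omega
      exact hne (by rw [h1]; simp)
  simp only [mul_assoc _ (prodBinom ϱ _)]
  rw [hfilter x y, hfilter y x, Finset.mul_sum, Finset.mul_sum]
  refine Finset.sum_nbij' (fun η => cfgJump η x y) (fun η => cfgJump η y x) ?_ ?_ ?_ ?_ ?_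
  · intro η hη
    simp only [Finset.mem_filter, Finset.mem_univ, true_and] at hη ⊢
    rw [cfgJump_left, cfgJump_right _ h]
    have := (η x).isLt
    omega
  · intro η hη
    simp only [Finset.mem_filter, Finset.mem_univ, true_and] at hη ⊢
    rw [cfgJump_left, cfgJump_right _ h.symm]
    have := (η y).isLt
    omega
  · intro η hη
    simp only [Finset.mem_filter, Finset.mem_univ, true_and] at hη
    exact cfgJump_cfgJump h hη.1 hη.2
  · intro η hη
    simp only [Finset.mem_filter, Finset.mem_univ, true_and] at hη
    exact cfgJump_cfgJump h.symm hη.1 hη.2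
  · intro η hη
    simp only [Finset.mem_filter, Finset.mem_univ, true_and] at hη
    linear_combination Φ (cfgJump η x y) * prodBinom_cfgJump hK ϱ h hη.1 hη.2

noncomputable section

/-- The rescaled centred occupation variable `(k - ϱ_x) / (ϱ_x (K - ϱ_x))`. -/
def fluct {N d K : ℕ} (ϱ : Site N d → ℝ) (x : Site N d) (k : Fin (K + 1)) : ℝ :=
  ((k.val : ℝ) - ϱ x) / (ϱ x * ((K : ℝ) - ϱ x))

/-- The part of the Dirichlet form carried by jumps from `x` to `y`. -/
def exchangeForm {N d K : ℕ} (f ν : GCfg N d K → ℝ) (x y : Site N d) : ℝ :=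
  ∑ η, (η x).val * ((K : ℝ) - (η y).val) * (√(f (cfgJump η x y)) - √(f η)) ^ 2 * ν η

end

theorem sum_fluct_mul_binomW {N d K : ℕ} (hK : 1 ≤ K) (ϱ : Site N d → ℝ) (x : Site N d) :
    ∑ k : Fin (K + 1), fluct ϱ x k * binomW K (ϱ x) k.val = 0 := by
  have h : ∀ k : Fin (K + 1), fluct ϱ x k * binomW K (ϱ x) k.val
      = (k.val * binomW K (ϱ x) k.val - ϱ x * binomW K (ϱ x) k.val)
        / (ϱ x * ((K : ℝ) - ϱ x)) := fun k => by unfold fluct; ring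
  simp only [h]
  rw [← Finset.sum_div, Finset.sum_sub_distrib, sum_mul_binomW hK, ← Finset.mul_sum, sum_binomW]
  simp

theorem abs_fluct_le {N d K : ℕ} {ϱ : Site N d → ℝ} {x : Site N d} {ε : ℝ} (hε : 0 < ε)
    (h0 : ε ≤ ϱ x) (h1 : ϱ x ≤ K - ε) (k : Fin (K + 1)) : |fluct ϱ x k| ≤ K / ε ^ 2 := by
  unfold fluct
  have h2 : ε ^ 2 ≤ ϱ x * ((K : ℝ) - ϱ x) := by nlinarith
  have h3 : (k.val : ℝ) ≤ K := by exact_mod_cast Nat.lt_succ_iff.1 k.isLt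
  have h4 : (0 : ℝ) ≤ k.val := Nat.cast_nonneg _
  have hpos : 0 < ϱ x * ((K : ℝ) - ϱ x) := (by positivity : 0 < ε ^ 2).trans_le h2
  rw [abs_div, abs_of_pos hpos]
  gcongr
  rw [abs_le]
  constructor <;> linarith

/-- The current identity behind the integration by parts. -/
theorem fluct_sub_fluct {N d K : ℕ} {ϱ : Site N d → ℝ} {x y : Site N d} (η : GCfg N d K)
    (hx : ϱ x * ((K : ℝ) - ϱ x) ≠ 0) (hy : ϱ y * ((K : ℝ) - ϱ y) ≠ 0) :
    K * (ϱ x * ((K : ℝ) - ϱ x)) * (ϱ y * ((K : ℝ) - ϱ y))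
        * (fluct ϱ x (η x) - fluct ϱ y (η y))
      = ϱ y * (K - ϱ x) * ((η x).val * (K - (η y).val))
        - ϱ x * (K - ϱ y) * ((η y).val * (K - (η x).val))
        - K * (ϱ x * ((K : ℝ) - ϱ x)) * (ϱ y * ((K : ℝ) - ϱ y))
          * ((ϱ x - ϱ y) * (fluct ϱ x (η x) * fluct ϱ y (η y))) := by
  have e1 : ϱ x * ((K : ℝ) - ϱ x) * fluct ϱ x (η x) = (η x).val - ϱ x := by
    unfold fluct; exact mul_div_cancel₀ _ hx
  have e2 : ϱ y * ((K : ℝ) - ϱ y) * fluct ϱ y (η y) = (η y).val - ϱ y := by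
    unfold fluct; exact mul_div_cancel₀ _ hy
  have e3 : K * (ϱ x * ((K : ℝ) - ϱ x)) * (ϱ y * ((K : ℝ) - ϱ y))
          * ((ϱ x - ϱ y) * (fluct ϱ x (η x) * fluct ϱ y (η y)))
      = K * (ϱ x - ϱ y) * (ϱ x * ((K : ℝ) - ϱ x) * fluct ϱ x (η x))
        * (ϱ y * ((K : ℝ) - ϱ y) * fluct ϱ y (η y)) := by ring
  rw [e3, e1, e2]
  linear_combination (K * (ϱ y * ((K : ℝ) - ϱ y))) * e1 - (K * (ϱ x * ((K : ℝ) - ϱ x))) * e2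

theorem mul_sub_le_sqrt_sub_sq {a b t s : ℝ} (ha : 0 ≤ a) (hb : 0 ≤ b) (hs : 0 < s) :
    t * (a - b) ≤ s * (√b - √a) ^ 2 + t ^ 2 / (2 * s) * (a + b) := by
  have ea := Real.sq_sqrt ha
  have eb := Real.sq_sqrt hb
  set u := √a
  set v := √b
  rw [← ea, ← eb]
  have h1 : 0 ≤ (s * (v - u) + t * (u + v) / 2) ^ 2 / s + t ^ 2 / (4 * s) * (u - v) ^ 2 := by
    positivity
  have h2 : (s * (v - u) + t * (u + v) / 2) ^ 2 / s + t ^ 2 / (4 * s) * (u - v) ^ 2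
      = s * (v - u) ^ 2 + t ^ 2 / (2 * s) * (u ^ 2 + v ^ 2) - t * (u ^ 2 - v ^ 2) := by
    field_simp
    ring
  linarith

theorem sum_mul_current_le {N d K : ℕ} (hK : 1 ≤ K) {ϱ : Site N d → ℝ} {β : ℝ}
    (hϱ0 : ∀ z, 0 < ϱ z) (hϱ1 : ∀ z, ϱ z < K) {x y : Site N d} (hxy : x ≠ y) (hβ : 0 < β)
    {f h : GCfg N d K → ℝ} (hf : ∀ η, 0 ≤ f η) (hh : ∀ η, h (cfgJump η x y) = h η) :
    ∑ η, h η * (ϱ y * (K - ϱ x) * ((η x).val * (K - (η y).val))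
        - ϱ x * (K - ϱ y) * ((η y).val * (K - (η x).val))) * (f η * prodBinom ϱ η)
      ≤ β * exchangeForm f (prodBinom ϱ) x y
        + K ^ 6 / β * ∑ η, h η ^ 2 * (f η * prodBinom ϱ η) := by
  have hK0 : (0 : ℝ) < K := by positivity
  have hν : ∀ η : GCfg N d K, 0 < prodBinom ϱ η := fun η =>
    Finset.prod_pos fun z _ => binomW_pos (hϱ0 z) (hϱ1 z) (Nat.lt_succ_iff.1 (η z).isLt)
  have hbound : ∀ z w, 0 ≤ ϱ z * (K - ϱ w) ∧ ϱ z * (K - ϱ w) ≤ K ^ 2 := fun z w => by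
    have h1 := hϱ0 z
    have h2 := hϱ1 z
    have h3 := hϱ0 w
    have h4 := hϱ1 w
    exact ⟨mul_nonneg (by linarith) (by linarith), by
      rw [sq]; exact mul_le_mul (by linarith) (by linarith) (by linarith) hK0.le⟩
  obtain ⟨hθ0, hθ1⟩ := hbound y x
  obtain ⟨hθ'0, hθ'1⟩ := hbound x y
  have hocc : ∀ (η : GCfg N d K) (z w : Site N d),
      0 ≤ ((η z).val : ℝ) * (K - (η w).val) ∧ ((η z).val : ℝ) * (K - (η w).val) ≤ K ^ 2 := by
    intro η z w
    have h1 : ((η z).val : ℝ) ≤ K := by exact_mod_cast Nat.lt_succ_iff.1 (η z).isLt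
    have h2 : ((η w).val : ℝ) ≤ K := by exact_mod_cast Nat.lt_succ_iff.1 (η w).isLt
    have h3 : (0 : ℝ) ≤ (η z).val := Nat.cast_nonneg _
    have h4 : (0 : ℝ) ≤ (η w).val := Nat.cast_nonneg _
    exact ⟨mul_nonneg h3 (by linarith), by
      rw [sq]; exact mul_le_mul h1 (by linarith) (by linarith) hK0.le⟩
  set S := ∑ η, h η ^ 2 * (f η * prodBinom ϱ η) with hS
  have hcv1 := sum_comp_cfgJump hK ϱ hxy (fun η => h η * f η)
  have hcv2 := sum_comp_cfgJump hK ϱ hxy (fun η => h η ^ 2 * f η)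
  simp only [hh] at hcv1 hcv2
  generalize ϱ y * (K - ϱ x) = θ at *
  generalize ϱ x * (K - ϱ y) = θ' at *
  have hI : ∑ η, h η
        * (θ * ((η x).val * (K - (η y).val)) - θ' * ((η y).val * (K - (η x).val)))
        * (f η * prodBinom ϱ η)
      = ∑ η : GCfg N d K, (η x).val * (K - (η y).val) * prodBinom ϱ η
        * ((θ * h η) * (f η - f (cfgJump η x y))) := by
    have : ∑ η, h η
        * (θ * ((η x).val * (K - (η y).val)) - θ' * ((η y).val * (K - (η x).val)))
        * (f η * prodBinom ϱ η)
        = θ * ∑ η : GCfg N d K, (η x).val * (K - (η y).val) * prodBinom ϱ η * (h η * f η)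
        - θ' * ∑ η : GCfg N d K,
            (η y).val * (K - (η x).val) * prodBinom ϱ η * (h η * f η) := by
      rw [Finset.mul_sum, Finset.mul_sum, ← Finset.sum_sub_distrib]
      exact Finset.sum_congr rfl fun η _ => by ring
    rw [this, ← hcv1, Finset.mul_sum, Finset.mul_sum, ← Finset.sum_sub_distrib]
    exact Finset.sum_congr rfl fun η _ => by ring
  have hJ : ∑ η : GCfg N d K, (η x).val * (K - (η y).val) * prodBinom ϱ η
        * ((θ * h η) * (f η - f (cfgJump η x y)))
      ≤ β * exchangeForm f (prodBinom ϱ) x y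
        + θ / (2 * β) * (θ * ∑ η : GCfg N d K,
            (η x).val * (K - (η y).val) * prodBinom ϱ η * (h η ^ 2 * f η)
          + θ * ∑ η : GCfg N d K,
            (η x).val * (K - (η y).val) * prodBinom ϱ η * (h η ^ 2 * f (cfgJump η x y))) := by
    unfold exchangeForm
    simp only [Finset.mul_sum, ← Finset.sum_add_distrib]
    refine Finset.sum_le_sum fun η _ => ?_
    have h1 := mul_le_mul_of_nonneg_left
      (mul_sub_le_sqrt_sub_sq (t := θ * h η) (hf η) (hf (cfgJump η x y)) hβ)
      (mul_nonneg (hocc η x y).1 (hν η).le)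
    refine h1.trans (le_of_eq ?_)
    ring
  have hK1 : ∀ z w : Site N d, ∑ η : GCfg N d K,
      (η z).val * (K - (η w).val) * prodBinom ϱ η * (h η ^ 2 * f η) ≤ K ^ 2 * S := by
    intro z w
    rw [hS, Finset.mul_sum]
    refine Finset.sum_le_sum fun η _ => ?_
    have h1 : 0 ≤ prodBinom ϱ η * (h η ^ 2 * f η) :=
      mul_nonneg (hν η).le (mul_nonneg (sq_nonneg _) (hf η))
    have h2 := mul_le_mul_of_nonneg_right (hocc η z w).2 h1
    linarith
  have hS0 : 0 ≤ S := Finset.sum_nonneg fun η _ =>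
    mul_nonneg (sq_nonneg _) (mul_nonneg (hf η) (hν η).le)
  rw [hcv2] at hJ
  rw [hI]
  refine hJ.trans ?_
  have hb1 : θ * ∑ η : GCfg N d K,
      (η x).val * (K - (η y).val) * prodBinom ϱ η * (h η ^ 2 * f η) ≤ K ^ 2 * (K ^ 2 * S) :=
    (mul_le_mul_of_nonneg_left (hK1 x y) hθ0).trans
      (mul_le_mul_of_nonneg_right hθ1 (by positivity))
  have hb2 : θ' * ∑ η : GCfg N d K,
      (η y).val * (K - (η x).val) * prodBinom ϱ η * (h η ^ 2 * f η) ≤ K ^ 2 * (K ^ 2 * S) :=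
    (mul_le_mul_of_nonneg_left (hK1 y x) hθ'0).trans
      (mul_le_mul_of_nonneg_right hθ'1 (by positivity))
  have hb3 : θ / (2 * β) * (θ * ∑ η : GCfg N d K,
            (η x).val * (K - (η y).val) * prodBinom ϱ η * (h η ^ 2 * f η)
          + θ' * ∑ η : GCfg N d K,
            (η y).val * (K - (η x).val) * prodBinom ϱ η * (h η ^ 2 * f η))
      ≤ K ^ 2 / (2 * β) * (K ^ 2 * (K ^ 2 * S) + K ^ 2 * (K ^ 2 * S)) :=
    (mul_le_mul_of_nonneg_left (add_le_add hb1 hb2) (by positivity)).trans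
      (mul_le_mul_of_nonneg_right (by gcongr) (by positivity))
  have e : K ^ 2 / (2 * β) * (K ^ 2 * (K ^ 2 * S) + K ^ 2 * (K ^ 2 * S))
      = K ^ 6 / β * S := by
    field_simp
    ring
  linarith

theorem sum_mul_gradient_le {N d K : ℕ} {ϱ : Site N d → ℝ} {ε δ β : ℝ} (hε : 0 < ε)
    (hϱ0 : ∀ z, ε ≤ ϱ z) (hϱ1 : ∀ z, ϱ z ≤ K - ε) {x y : Site N d}
    (hδ : |ϱ x - ϱ y| ≤ δ) (hβ : 0 < β) {w h : GCfg N d K → ℝ} (hw : ∀ η, 0 ≤ w η)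
    (hw1 : ∑ η, w η = 1) :
    ∑ η, -(h η * ((ϱ x - ϱ y) * (fluct ϱ x (η x) * fluct ϱ y (η y)))) * w η
      ≤ 1 / β * ∑ η, h η ^ 2 * w η + β * (δ ^ 2 * (K / ε ^ 2) ^ 4) := by
  have : β * (δ ^ 2 * (K / ε ^ 2) ^ 4)
      = ∑ η, β * (δ ^ 2 * (K / ε ^ 2) ^ 4) * w η := by
    rw [← Finset.mul_sum, hw1, mul_one]
  rw [this, Finset.mul_sum, ← Finset.sum_add_distrib]
  refine Finset.sum_le_sum fun η _ => ?_
  set g := (ϱ x - ϱ y) * (fluct ϱ x (η x) * fluct ϱ y (η y)) with hg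
  have hg2 : g ^ 2 ≤ δ ^ 2 * (K / ε ^ 2) ^ 4 := by
    have h1 : |g| ≤ δ * (K / ε ^ 2 * (K / ε ^ 2)) := by
      rw [hg, abs_mul, abs_mul]
      gcongr
      · exact (abs_nonneg _).trans hδ
      · exact abs_fluct_le hε (hϱ0 x) (hϱ1 x) _
      · exact abs_fluct_le hε (hϱ0 y) (hϱ1 y) _
    calc g ^ 2 = |g| ^ 2 := (sq_abs g).symm
      _ ≤ (δ * (K / ε ^ 2 * (K / ε ^ 2))) ^ 2 := by gcongr
      _ = _ := by ring
  have h2 : -(h η * g) ≤ 1 / β * h η ^ 2 + β * g ^ 2 := by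
    have h3 : 0 ≤ (h η + β * g / 2) ^ 2 / β + 3 / 4 * β * g ^ 2 := by positivity
    have h4 : (h η + β * g / 2) ^ 2 / β + 3 / 4 * β * g ^ 2
        = 1 / β * h η ^ 2 + β * g ^ 2 + h η * g := by field_simp; ring
    linarith
  have h5 : -(h η * g) ≤ 1 / β * h η ^ 2 + β * (δ ^ 2 * (K / ε ^ 2) ^ 4) :=
    h2.trans (by gcongr)
  have h6 := mul_le_mul_of_nonneg_right h5 (hw η)
  linarith

theorem sum_mul_fluct_sub_le {N d K : ℕ} (hK : 1 ≤ K) {ϱ : Site N d → ℝ} {ε δ β : ℝ} (hε : 0 < ε)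
    (hϱ0 : ∀ z, ε ≤ ϱ z) (hϱ1 : ∀ z, ϱ z ≤ K - ε) {x y : Site N d} (hxy : x ≠ y)
    (hδ : |ϱ x - ϱ y| ≤ δ) (hβ : 0 < β) {f h : GCfg N d K → ℝ} (hf : ∀ η, 0 ≤ f η)
    (hf1 : ∑ η, f η * prodBinom ϱ η = 1) (hh : ∀ η, h (cfgJump η x y) = h η) :
    ∑ η, h η * (fluct ϱ x (η x) - fluct ϱ y (η y)) * (f η * prodBinom ϱ η)
      ≤ β * exchangeForm f (prodBinom ϱ) x y
        + (K ^ 4 / ε ^ 8 + 1) / β * ∑ η, h η ^ 2 * (f η * prodBinom ϱ η)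
        + β * (δ ^ 2 * (K / ε ^ 2) ^ 4) := by
  have hK0 : (0 : ℝ) < K := by positivity
  have hν : ∀ η : GCfg N d K, 0 < prodBinom ϱ η := fun η =>
    Finset.prod_pos fun z _ => binomW_pos (hε.trans_le (hϱ0 z)) (by linarith [hϱ1 z])
      (Nat.lt_succ_iff.1 (η z).isLt)
  have hχ : ∀ z, ε ^ 2 ≤ ϱ z * ((K : ℝ) - ϱ z) := fun z => by
    have := hϱ0 z
    have := hϱ1 z
    nlinarith
  have hχ0 : ∀ z, 0 < ϱ z * ((K : ℝ) - ϱ z) := fun z => lt_of_lt_of_le (by positivity) (hχ z)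
  set A := K * (ϱ x * ((K : ℝ) - ϱ x)) * (ϱ y * ((K : ℝ) - ϱ y)) with hA
  have hApos : 0 < A := mul_pos (mul_pos hK0 (hχ0 x)) (hχ0 y)
  have hAge : K * ε ^ 4 ≤ A := by
    have := mul_le_mul (hχ x) (hχ y) (by positivity) (hχ0 x).le
    have := mul_le_mul_of_nonneg_left this hK0.le
    rw [hA]
    calc (K : ℝ) * ε ^ 4 = K * (ε ^ 2 * ε ^ 2) := by ring
      _ ≤ _ := this
      _ = _ := by ring
  have hsplit : ∀ η : GCfg N d K, h η * (fluct ϱ x (η x) - fluct ϱ y (η y))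
      = A⁻¹ * (h η * (ϱ y * (K - ϱ x) * ((η x).val * (K - (η y).val))
        - ϱ x * (K - ϱ y) * ((η y).val * (K - (η x).val))))
      + -(h η * ((ϱ x - ϱ y) * (fluct ϱ x (η x) * fluct ϱ y (η y)))) := fun η => by
    have h1 := fluct_sub_fluct η (hχ0 x).ne' (hχ0 y).ne'
    rw [← hA] at h1
    have h2 : A⁻¹ * A = 1 := inv_mul_cancel₀ hApos.ne'
    linear_combination (A⁻¹ * h η) * h1 - (h η * (fluct ϱ x (η x) - fluct ϱ y (η y))
      + h η * ((ϱ x - ϱ y) * (fluct ϱ x (η x) * fluct ϱ y (η y)))) * h2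
  have hcur := sum_mul_current_le hK (fun z => hε.trans_le (hϱ0 z))
    (fun z => by linarith [hϱ1 z]) hxy (mul_pos hApos hβ) hf hh
  have hgrad := sum_mul_gradient_le hε hϱ0 hϱ1 hδ hβ (h := h)
    (fun η => mul_nonneg (hf η) (hν η).le) hf1
  have hS0 : 0 ≤ ∑ η, h η ^ 2 * (f η * prodBinom ϱ η) := Finset.sum_nonneg fun η _ =>
    mul_nonneg (sq_nonneg _) (mul_nonneg (hf η) (hν η).le)
  clear_value A
  simp only [hsplit, add_mul, Finset.sum_add_distrib, mul_assoc A⁻¹, ← Finset.mul_sum]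
  set S := ∑ η, h η ^ 2 * (f η * prodBinom ϱ η)
  have hcur' := mul_le_mul_of_nonneg_left hcur (inv_pos.2 hApos).le
  have e1 : A⁻¹ * (A * β * exchangeForm f (prodBinom ϱ) x y + K ^ 6 / (A * β) * S)
      = β * exchangeForm f (prodBinom ϱ) x y + K ^ 6 / A ^ 2 / β * S := by
    field_simp
  have e2 : K ^ 6 / A ^ 2 / β * S ≤ K ^ 4 / ε ^ 8 / β * S := by
    have : K ^ 6 / A ^ 2 ≤ K ^ 4 / ε ^ 8 := by
      calc (K : ℝ) ^ 6 / A ^ 2 ≤ K ^ 6 / (K * ε ^ 4) ^ 2 := by gcongr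
        _ = _ := by field_simp
    gcongr
  have e3 : (K ^ 4 / ε ^ 8 + 1) / β * S = K ^ 4 / ε ^ 8 / β * S + 1 / β * S := by ring
  rw [e1] at hcur'
  linarith [add_mul (K ^ 4 / ε ^ 8) 1 (S / β)]

theorem sum_fluct_quadratic_le {N d K : ℕ} (hK : 1 ≤ K) {ϱ : Site N d → ℝ} {ε q θ : ℝ}
    (hε : 0 < ε) (hϱ0 : ∀ z, ε ≤ ϱ z) (hϱ1 : ∀ z, ϱ z ≤ K - ε) {Q : Site N d → Site N d → ℝ}
    (hq : 0 ≤ q) (hent : ∀ x y, |Q x y| ≤ q) (hrow : ∀ x, ∑ y, |Q x y| ≤ θ)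
    (hcol : ∀ y, ∑ x, |Q x y| ≤ θ) (hθ : 0 < θ) {μ : GCfg N d K → ℝ} (hμ : ∀ η, 0 ≤ μ η)
    (hμ1 : ∑ η, μ η = 1) :
    ∑ η, (∑ x, ∑ y, Q x y * (fluct ϱ x (η x) * fluct ϱ y (η y))) * μ η
      ≤ 8 * (K / ε ^ 2) ^ 2 * θ * relEnt μ (prodBinom ϱ)
        + 2 * (K / ε ^ 2) ^ 2 * q * (N : ℝ) ^ d := by
  have hc : (0 : ℝ) < K / ε ^ 2 := by positivity
  have hw : ∀ (x : Site N d) (k : Fin (K + 1)), 0 < binomW K (ϱ x) k.val := fun x k =>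
    binomW_pos (hε.trans_le (hϱ0 x)) (by linarith [hϱ1 x]) (Nat.lt_succ_iff.1 k.isLt)
  have h := sum_quadratic_mul_le (α := Fin (K + 1)) hc hw (fun x => sum_binomW K (ϱ x))
    (X := fluct ϱ) (fun x => sum_fluct_mul_binomW hK ϱ x)
    (fun x k => abs_fluct_le hε (hϱ0 x) (hϱ1 x) k) hq hent hrow hcol hθ hμ hμ1
  have hcard : ((Fintype.card (Site N d) : ℕ) : ℝ) = (N : ℝ) ^ d := by
    simp [Site]
  rw [hcard] at h
  exact h

noncomputable section

/-- The kernel replacing `X (x + e_i)` by the average of `X` over a box attached to `x + e_i`. -/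
def blockKernel {N d : ℕ} [NeZero N] (a : Fin d → Site N d → ℝ) (ℓ : ℕ) (x y : Site N d) : ℝ :=
  ∑ i, a i x * boxWeight ℓ (y - (x + Pi.single i 1))

/-- The coefficient of `X x` in front of the gradient of `X` across the edge from `z` in
direction `j`, in the decomposition of `sum_mul_mul_eq`. -/
def flowKernel {N d : ℕ} [NeZero N] (a : Fin d → Site N d → ℝ) (ℓ : ℕ) (j : Fin d)
    (z x : Site N d) : ℝ :=
  ∑ i, a i x * boxFlow ℓ j (z - (x + Pi.single i 1))

end

theorem eq_boxAverage_add_sum_boxFlow {N d ℓ : ℕ} [NeZero N] (hℓ : 1 ≤ ℓ) (hℓN : ℓ ≤ N)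
    (X : Site N d → ℝ) (w : Site N d) :
    X w = ∑ y, boxWeight ℓ (y - w) * X y
      + ∑ j : Fin d, ∑ z, boxFlow ℓ j (z - w) * (X z - X (z + Pi.single j 1)) := by
  have h : ∀ y : Site N d, (∑ j : Fin d, (boxFlow ℓ j (y - w)
      - boxFlow ℓ j (y - Pi.single j 1 - w))) * X y
      = (if y = w then X y else 0) - boxWeight ℓ (y - w) * X y := fun y => by
    have h1 := sum_boxFlow_sub (d := d) hℓ hℓN (y - w)
    simp only [sub_right_comm y _ w]
    rw [h1, sub_mul]
    simp [sub_eq_zero]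
  have h2 : ∑ y, (∑ j : Fin d, (boxFlow ℓ j (y - w) - boxFlow ℓ j (y - Pi.single j 1 - w))) * X y
      = ∑ j : Fin d, ∑ z, boxFlow ℓ j (z - w) * (X z - X (z + Pi.single j 1)) := by
    simp only [Finset.sum_mul]
    rw [Finset.sum_comm]
    refine Finset.sum_congr rfl fun j _ => ?_
    simp only [sub_mul, mul_sub, Finset.sum_sub_distrib]
    congr 1
    rw [← Equiv.sum_comp (Equiv.addRight (Pi.single j (1 : Fin N)))]
    simp
  rw [← h2, Finset.sum_congr rfl fun y _ => h y]
  simp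

theorem sum_mul_mul_eq {N d ℓ : ℕ} [NeZero N] (hℓ : 1 ≤ ℓ) (hℓN : ℓ ≤ N)
    (a : Fin d → Site N d → ℝ) (X : Site N d → ℝ) :
    ∑ i, ∑ x, a i x * X x * X (x + Pi.single i 1)
      = ∑ x, ∑ y, blockKernel a ℓ x y * (X x * X y)
        + ∑ j, ∑ z, (∑ x, flowKernel a ℓ j z x * X x) * (X z - X (z + Pi.single j 1)) := by
  have h : ∀ i x, a i x * X x * X (x + Pi.single i 1)
      = ∑ y, a i x * boxWeight ℓ (y - (x + Pi.single i 1)) * (X x * X y)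
        + ∑ j, ∑ z, a i x * boxFlow ℓ j (z - (x + Pi.single i 1)) * X x
          * (X z - X (z + Pi.single j 1)) := fun i x => by
    conv_lhs => rw [eq_boxAverage_add_sum_boxFlow hℓ hℓN X (x + Pi.single i 1)]
    rw [mul_add, Finset.mul_sum, Finset.mul_sum]
    congr 1
    · exact Finset.sum_congr rfl fun y _ => by ring
    · refine Finset.sum_congr rfl fun j _ => ?_
      rw [Finset.mul_sum]
      exact Finset.sum_congr rfl fun y _ => by ring
  simp only [h, Finset.sum_add_distrib]
  congr 1
  · rw [Finset.sum_comm]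
    refine Finset.sum_congr rfl fun x _ => ?_
    rw [Finset.sum_comm]
    refine Finset.sum_congr rfl fun y _ => ?_
    rw [blockKernel, Finset.sum_mul]
  · have e : ∀ j z, (∑ x, flowKernel a ℓ j z x * X x) * (X z - X (z + Pi.single j 1))
        = ∑ i, ∑ x, a i x * boxFlow ℓ j (z - (x + Pi.single i 1)) * X x
          * (X z - X (z + Pi.single j 1)) := fun j z => by
      rw [Finset.sum_comm, Finset.sum_mul]
      refine Finset.sum_congr rfl fun x _ => ?_
      rw [flowKernel, Finset.sum_mul, Finset.sum_mul]
    simp only [e]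
    calc _ = ∑ i, ∑ j, ∑ x, ∑ z, a i x * boxFlow ℓ j (z - (x + Pi.single i 1)) * X x
          * (X z - X (z + Pi.single j 1)) := Finset.sum_congr rfl fun i _ => Finset.sum_comm
      _ = ∑ j, ∑ i, ∑ z, ∑ x, a i x * boxFlow ℓ j (z - (x + Pi.single i 1)) * X x
          * (X z - X (z + Pi.single j 1)) := by
        rw [Finset.sum_comm]
        exact Finset.sum_congr rfl fun j _ => Finset.sum_congr rfl fun i _ => Finset.sum_comm
      _ = _ := Finset.sum_congr rfl fun j _ => Finset.sum_comm

section

variable {N d ℓ : ℕ} [NeZero N] {a : Fin d → Site N d → ℝ} {A : ℝ}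

theorem abs_blockKernel_le (hA : ∀ i x, |a i x| ≤ A) (x y : Site N d) :
    |blockKernel a ℓ x y| ≤ d * A * ((ℓ : ℝ)⁻¹) ^ d := by
  calc |blockKernel a ℓ x y|
      ≤ ∑ i : Fin d, |a i x * boxWeight ℓ (y - (x + Pi.single i 1))| :=
        Finset.abs_sum_le_sum_abs _ _
    _ ≤ ∑ i : Fin d, A * ((ℓ : ℝ)⁻¹) ^ d := Finset.sum_le_sum fun i _ => by
        rw [abs_mul, abs_of_nonneg (boxWeight_nonneg _ _)]
        exact mul_le_mul (hA i x) (boxWeight_le _ _) (boxWeight_nonneg _ _)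
          ((abs_nonneg _).trans (hA i x))
    _ = _ := by simp [mul_assoc]

theorem sum_abs_kernel_row_le {φ : Site N d → ℝ} {s : ℝ} (hφ : ∀ y, 0 ≤ φ y)
    (hs : ∑ y, φ y ≤ s) (hA : ∀ i x, |a i x| ≤ A) (x : Site N d) :
    ∑ y, |∑ i, a i x * φ (y - (x + Pi.single i 1))| ≤ d * A * s := by
  have hshift : ∀ w : Site N d, ∑ y, φ (y - w) = ∑ y, φ y := fun w =>
    Equiv.sum_comp (Equiv.subRight w) φ
  calc ∑ y, |∑ i, a i x * φ (y - (x + Pi.single i 1))|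
      ≤ ∑ y, ∑ i, A * φ (y - (x + Pi.single i 1)) := Finset.sum_le_sum fun y _ =>
        (Finset.abs_sum_le_sum_abs _ _).trans <| Finset.sum_le_sum fun i _ => by
          rw [abs_mul, abs_of_nonneg (hφ _)]
          exact mul_le_mul_of_nonneg_right (hA i x) (hφ _)
    _ = ∑ i : Fin d, A * ∑ y, φ y := by
        rw [Finset.sum_comm]
        refine Finset.sum_congr rfl fun i _ => ?_
        rw [← Finset.mul_sum]
        exact congrArg (A * ·) (hshift _)
    _ ≤ ∑ i : Fin d, A * s := Finset.sum_le_sum fun i _ =>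
        mul_le_mul_of_nonneg_left hs ((abs_nonneg _).trans (hA i x))
    _ = _ := by simp [mul_assoc]

theorem sum_abs_kernel_col_le {φ : Site N d → ℝ} {s : ℝ} (hφ : ∀ y, 0 ≤ φ y)
    (hs : ∑ y, φ y ≤ s) (hA : ∀ i x, |a i x| ≤ A) (y : Site N d) :
    ∑ x, |∑ i, a i x * φ (y - (x + Pi.single i 1))| ≤ d * A * s := by
  calc ∑ x, |∑ i, a i x * φ (y - (x + Pi.single i 1))|
      ≤ ∑ x, ∑ i, A * φ (y - (x + Pi.single i 1)) := Finset.sum_le_sum fun x _ =>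
        (Finset.abs_sum_le_sum_abs _ _).trans <| Finset.sum_le_sum fun i _ => by
          rw [abs_mul, abs_of_nonneg (hφ _)]
          exact mul_le_mul_of_nonneg_right (hA i x) (hφ _)
    _ = ∑ i : Fin d, A * ∑ y, φ y := by
        rw [Finset.sum_comm]
        refine Finset.sum_congr rfl fun i _ => ?_
        rw [← Finset.mul_sum, ← Equiv.sum_comp (Equiv.subLeft (y - Pi.single i 1)) φ]
        congr 1
        refine Finset.sum_congr rfl fun x _ => ?_
        rw [Equiv.subLeft_apply]
        congr 1
        abel
    _ ≤ ∑ i : Fin d, A * s := Finset.sum_le_sum fun i _ =>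
        mul_le_mul_of_nonneg_left hs ((abs_nonneg _).trans (hA i y))
    _ = _ := by simp [mul_assoc]

theorem sum_abs_mul_flowKernel_le {j : Fin d} {G : ℝ} (hG : ∑ y : Site N d, boxFlow ℓ j y ^ 2 ≤ G)
    (hA : ∀ i x, |a i x| ≤ A) (x x' : Site N d) :
    ∑ z, |flowKernel a ℓ j z x * flowKernel a ℓ j z x'| ≤ (d * A) ^ 2 * G := by
  have hA0 : 0 ≤ A := (abs_nonneg _).trans (hA j x)
  have habs : ∀ z x : Site N d,
      |flowKernel a ℓ j z x| ≤ ∑ i, A * boxFlow ℓ j (z - (x + Pi.single i 1)) := fun z x =>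
    (Finset.abs_sum_le_sum_abs _ _).trans <| Finset.sum_le_sum fun i _ => by
      rw [abs_mul, abs_of_nonneg (boxFlow_nonneg _ _ _)]
      exact mul_le_mul_of_nonneg_right (hA i x) (boxFlow_nonneg _ _ _)
  have hcs : ∀ u v : Site N d, ∑ z, boxFlow ℓ j (z - u) * boxFlow ℓ j (z - v) ≤ G := by
    intro u v
    have h : ∀ w : Site N d, ∑ z, boxFlow ℓ j (z - w) ^ 2 ≤ G := fun w => by
      exact (Equiv.sum_comp (Equiv.subRight w) fun y => boxFlow ℓ j y ^ 2).trans_le hG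
    calc ∑ z, boxFlow ℓ j (z - u) * boxFlow ℓ j (z - v)
        ≤ ∑ z, (boxFlow ℓ j (z - u) ^ 2 / 2 + boxFlow ℓ j (z - v) ^ 2 / 2) :=
          Finset.sum_le_sum fun z _ => by
            nlinarith [sq_nonneg (boxFlow ℓ j (z - u) - boxFlow ℓ j (z - v))]
      _ ≤ G := by
          rw [Finset.sum_add_distrib, ← Finset.sum_div, ← Finset.sum_div]
          linarith [h u, h v]
  calc ∑ z, |flowKernel a ℓ j z x * flowKernel a ℓ j z x'|
      ≤ ∑ z, (∑ i, A * boxFlow ℓ j (z - (x + Pi.single i 1)))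
          * ∑ k, A * boxFlow ℓ j (z - (x' + Pi.single k 1)) := Finset.sum_le_sum fun z _ => by
        rw [abs_mul]
        exact mul_le_mul (habs z x) (habs z x') (abs_nonneg _) ((abs_nonneg _).trans (habs z x))
    _ = ∑ i : Fin d, ∑ k : Fin d, A ^ 2 * ∑ z, boxFlow ℓ j (z - (x + Pi.single i 1))
          * boxFlow ℓ j (z - (x' + Pi.single k 1)) := by
        rw [Finset.sum_congr rfl fun z _ => Finset.sum_mul_sum _ _ _ _, Finset.sum_comm]
        refine Finset.sum_congr rfl fun i _ => ?_
        rw [Finset.sum_comm]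
        refine Finset.sum_congr rfl fun k _ => ?_
        rw [Finset.mul_sum]
        exact Finset.sum_congr rfl fun z _ => by ring
    _ ≤ ∑ i : Fin d, ∑ k : Fin d, A ^ 2 * G := Finset.sum_le_sum fun i _ =>
        Finset.sum_le_sum fun k _ => mul_le_mul_of_nonneg_left (hcs _ _) (sq_nonneg _)
    _ = _ := by simp; ring

theorem flowKernel_self (hℓN : ℓ + 2 ≤ N) (j : Fin d) (z : Site N d) :
    flowKernel a ℓ j z z = 0 := by
  have hN : 1 < N := by omega
  refine Finset.sum_eq_zero fun i _ => ?_
  rw [boxFlow_eq_zero (i := i) j, mul_zero]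
  have h1 : ((1 : Fin N)).val = 1 := by simp [Nat.mod_eq_of_lt hN]
  simp only [Pi.sub_apply, Pi.add_apply, Pi.single_eq_same, Fin.val_sub, Fin.val_add, h1]
  have hz := (z i).isLt
  rcases Nat.lt_or_ge ((z i).val + 1) N with h | h
  · rw [Nat.mod_eq_of_lt h, Nat.mod_eq_of_lt (by omega)]
    omega
  · have h2 : (z i).val + 1 = N := by omega
    rw [h2, Nat.mod_self, Nat.sub_zero, Nat.add_mod_left, Nat.mod_eq_of_lt hz]
    omega

theorem flowKernel_add (hℓN : ℓ + 2 ≤ N) (j : Fin d) (z : Site N d) :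
    flowKernel a ℓ j z (z + Pi.single j 1) = 0 := by
  have hN : 1 < N := by omega
  have h1 : ((1 : Fin N)).val = 1 := by simp [Nat.mod_eq_of_lt hN]
  have key : ∀ b c : Fin N, c.val = 1 ∨ c.val = 2 % N → ℓ ≤ (b - (b + c)).val := by
    intro b c hc
    have h : b - (b + c) = -c := by abel
    have h0 : c.val % N = c.val := Nat.mod_eq_of_lt c.isLt
    rw [h]
    rcases Nat.lt_or_ge 2 N with h2 | h2
    · rw [Nat.mod_eq_of_lt h2] at hc
      rw [Fin.val_neg']
      rw [Nat.mod_eq_of_lt (by omega)]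
      omega
    · have : ℓ = 0 := by omega
      omega
  refine Finset.sum_eq_zero fun i _ => ?_
  rw [boxFlow_eq_zero (i := i) j, mul_zero]
  simp only [Pi.sub_apply, Pi.add_apply, Pi.single_eq_same]
  rw [add_assoc]
  apply key
  by_cases h : i = j
  · subst h
    right
    rw [Pi.single_eq_same, Fin.val_add, h1]
  · left
    rw [Pi.single_eq_of_ne h, zero_add, h1]

end

theorem dirichletForm_eq {N d K : ℕ} [NeZero N] (p : Fin d → Bool → ℝ) (f ν : GCfg N d K → ℝ) :
    dirichletForm p f ν = ∑ i, ∑ x, (p i true * exchangeForm f ν x (x + Pi.single i 1)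
      + p i false * exchangeForm f ν (x + Pi.single i 1) x) := by
  unfold dirichletForm
  refine Finset.sum_congr rfl fun i _ => ?_
  have h : ∀ b x, ∑ η, jumpRate p η x i b
      * (√(f (cfgJump η x (siteMove x i b))) - √(f η)) ^ 2 * ν η
      = p i b * exchangeForm f ν x (siteMove x i b) := fun b x => by
    rw [exchangeForm, Finset.mul_sum]
    exact Finset.sum_congr rfl fun η _ => by rw [jumpRate]; ring
  simp only [Fintype.sum_bool, h, Finset.sum_add_distrib]
  congr 1
  · simp only [siteMove_true]
  · rw [← Equiv.sum_comp (Equiv.addRight (Pi.single i (1 : Fin N)))]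
    simp only [Equiv.coe_addRight, siteMove_add_false]

theorem exchangeForm_nonneg {N d K : ℕ} {f ν : GCfg N d K → ℝ} (hν : ∀ η, 0 ≤ ν η)
    (x y : Site N d) : 0 ≤ exchangeForm f ν x y := by
  refine Finset.sum_nonneg fun η _ => ?_
  have h : ((η y).val : ℝ) ≤ K := by exact_mod_cast Nat.lt_succ_iff.1 (η y).isLt
  exact mul_nonneg (mul_nonneg (mul_nonneg (Nat.cast_nonneg _) (by linarith)) (sq_nonneg _)) (hν η)

theorem prodBinom_pos {N d K : ℕ} {ϱ : Site N d → ℝ} (h0 : ∀ z, 0 < ϱ z) (h1 : ∀ z, ϱ z < K)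
    (η : GCfg N d K) : 0 < prodBinom ϱ η :=
  Finset.prod_pos fun z _ => binomW_pos (h0 z) (h1 z) (Nat.lt_succ_iff.1 (η z).isLt)

theorem sum_mul_fluct_sub_le_rate {N d K : ℕ} (hK : 1 ≤ K) {ϱ : Site N d → ℝ}
    {ε δ B P ς r r' : ℝ} (hε : 0 < ε) (hϱ0 : ∀ z, ε ≤ ϱ z) (hϱ1 : ∀ z, ϱ z ≤ K - ε)
    {x y : Site N d} (hxy : x ≠ y) (hδ : |ϱ x - ϱ y| ≤ δ) (hB : 0 < B) (hς : 0 < ς)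
    (hr : 0 ≤ r) (hr' : 0 ≤ r') (hrP : r ≤ P) (hrP' : r' ≤ P) (hrr : ς ≤ r ∨ ς ≤ r')
    {f h : GCfg N d K → ℝ} (hf : ∀ η, 0 ≤ f η) (hf1 : ∑ η, f η * prodBinom ϱ η = 1)
    (hh : ∀ η, h (cfgJump η x y) = h η) (hh' : ∀ η, h (cfgJump η y x) = h η) :
    ∑ η, h η * (fluct ϱ x (η x) - fluct ϱ y (η y)) * (f η * prodBinom ϱ η)
      ≤ B * (r * exchangeForm f (prodBinom ϱ) x y + r' * exchangeForm f (prodBinom ϱ) y x)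
        + (K ^ 4 / ε ^ 8 + 1) / (B * ς) * ∑ η, h η ^ 2 * (f η * prodBinom ϱ η)
        + B * P * (δ ^ 2 * (K / ε ^ 2) ^ 4) := by
  have hν := fun η : GCfg N d K => (prodBinom_pos (fun z => hε.trans_le (hϱ0 z))
    (fun z => by linarith [hϱ1 z]) η).le
  have hE := exchangeForm_nonneg (f := f) hν x y
  have hE' := exchangeForm_nonneg (f := f) hν y x
  have hS : 0 ≤ ∑ η, h η ^ 2 * (f η * prodBinom ϱ η) := Finset.sum_nonneg fun η _ =>
    mul_nonneg (sq_nonneg _) (mul_nonneg (hf η) (hν η))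
  have hmono : ∀ s, ς ≤ s → s ≤ P →
      (K ^ 4 / ε ^ 8 + 1) / (B * s) * ∑ η, h η ^ 2 * (f η * prodBinom ϱ η)
        + B * s * (δ ^ 2 * (K / ε ^ 2) ^ 4)
      ≤ (K ^ 4 / ε ^ 8 + 1) / (B * ς) * ∑ η, h η ^ 2 * (f η * prodBinom ϱ η)
        + B * P * (δ ^ 2 * (K / ε ^ 2) ^ 4) := fun s h1 h2 => by gcongr
  rcases hrr with hr1 | hr1
  · have h1 := sum_mul_fluct_sub_le hK hε hϱ0 hϱ1 hxy hδ (mul_pos hB (hς.trans_le hr1)) hf hf1 hh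
    have h2 := hmono r hr1 hrP
    have h3 : 0 ≤ B * (r' * exchangeForm f (prodBinom ϱ) y x) := by positivity
    linarith
  · have h1 := sum_mul_fluct_sub_le (h := fun η => -h η) (δ := δ) hK hε hϱ0 hϱ1 hxy.symm
      (abs_sub_comm (ϱ x) (ϱ y) ▸ hδ) (mul_pos hB (hς.trans_le hr1)) hf hf1 (fun η => by rw [hh'])
    have h2 := hmono r' hr1 hrP'
    have h3 : 0 ≤ B * (r * exchangeForm f (prodBinom ϱ) x y) := by positivity
    have h4 : ∑ η, -h η * (fluct ϱ y (η y) - fluct ϱ x (η x)) * (f η * prodBinom ϱ η)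
        = ∑ η, h η * (fluct ϱ x (η x) - fluct ϱ y (η y)) * (f η * prodBinom ϱ η) :=
      Finset.sum_congr rfl fun η _ => by ring
    simp only [neg_sq] at h1
    linarith

theorem sum_flow_sq_le {N d K ℓ : ℕ} [NeZero N] (hd : 1 ≤ d) (hK : 1 ≤ K) (hℓ : 1 ≤ ℓ)
    (hℓN : ℓ ≤ N) {ϱ : Site N d → ℝ} {ε A G : ℝ} (hε : 0 < ε) (hϱ0 : ∀ z, ε ≤ ϱ z)
    (hϱ1 : ∀ z, ϱ z ≤ K - ε) {a : Fin d → Site N d → ℝ} (hA0 : 0 < A) (hA : ∀ i x, |a i x| ≤ A)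
    (j : Fin d) (hG : ∑ y : Site N d, boxFlow ℓ j y ^ 2 ≤ G) {μ : GCfg N d K → ℝ}
    (hμ : ∀ η, 0 ≤ μ η) (hμ1 : ∑ η, μ η = 1) :
    ∑ z, ∑ η, (∑ x, flowKernel a ℓ j z x * fluct ϱ x (η x)) ^ 2 * μ η
      ≤ 8 * (K / ε ^ 2) ^ 2 * (d * A * ℓ) ^ 2 * relEnt μ (prodBinom ϱ)
        + 2 * (K / ε ^ 2) ^ 2 * ((d * A) ^ 2 * G) * (N : ℝ) ^ d := by
  have hG0 : 0 ≤ G := (Finset.sum_nonneg fun y _ => sq_nonneg _).trans hG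
  have hs : ∑ y : Site N d, boxFlow ℓ j y ≤ ℓ :=
    (sum_boxFlow_le hℓN j).trans (by exact_mod_cast Nat.sub_le _ _)
  have hrow := sum_abs_kernel_row_le (boxFlow_nonneg ℓ j) hs hA
  have hcol := sum_abs_kernel_col_le (boxFlow_nonneg ℓ j) hs hA
  have hent : ∀ x y, |∑ z, flowKernel a ℓ j z x * flowKernel a ℓ j z y| ≤ (d * A) ^ 2 * G :=
    fun x y => (Finset.abs_sum_le_sum_abs _ _).trans (sum_abs_mul_flowKernel_le hG hA x y)
  have hQrow : ∀ x, ∑ y, |∑ z, flowKernel a ℓ j z x * flowKernel a ℓ j z y|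
      ≤ (d * A * ℓ) ^ 2 := by
    intro x
    calc ∑ y, |∑ z, flowKernel a ℓ j z x * flowKernel a ℓ j z y|
        ≤ ∑ y, ∑ z, |flowKernel a ℓ j z x| * |flowKernel a ℓ j z y| :=
          Finset.sum_le_sum fun y _ => (Finset.abs_sum_le_sum_abs _ _).trans_eq
            (Finset.sum_congr rfl fun z _ => abs_mul _ _)
      _ = ∑ z, |flowKernel a ℓ j z x| * ∑ y, |flowKernel a ℓ j z y| := by
          rw [Finset.sum_comm]
          exact Finset.sum_congr rfl fun z _ => by rw [Finset.mul_sum]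
      _ ≤ ∑ z, |flowKernel a ℓ j z x| * (d * A * ℓ) := Finset.sum_le_sum fun z _ =>
          mul_le_mul_of_nonneg_left (hcol z) (abs_nonneg _)
      _ ≤ (d * A * ℓ) * (d * A * ℓ) := by
          rw [← Finset.sum_mul]
          exact mul_le_mul_of_nonneg_right (hrow x) (by positivity)
      _ = _ := by ring
  have hQcol : ∀ y, ∑ x, |∑ z, flowKernel a ℓ j z x * flowKernel a ℓ j z y|
      ≤ (d * A * ℓ) ^ 2 := fun y => by
    simpa only [mul_comm] using hQrow y
  have h := sum_fluct_quadratic_le hK hε hϱ0 hϱ1 (by positivity) hent hQrow hQcol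
    (by positivity) hμ hμ1
  refine le_of_eq_of_le ?_ h
  rw [Finset.sum_comm]
  refine Finset.sum_congr rfl fun η _ => ?_
  rw [← Finset.sum_mul]
  congr 1
  simp only [sq, Finset.sum_mul_sum]
  rw [Finset.sum_comm]
  refine Finset.sum_congr rfl fun x _ => ?_
  rw [Finset.sum_comm]
  refine Finset.sum_congr rfl fun y _ => ?_
  rw [Finset.sum_mul]
  exact Finset.sum_congr rfl fun z _ => by ring

theorem sum_flow_mul_le {N d K ℓ : ℕ} [NeZero N] (hd : 1 ≤ d) (hK : 1 ≤ K) (hℓ : 1 ≤ ℓ)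
    (hℓN : ℓ + 2 ≤ N) {ϱ : Site N d → ℝ} {ε δ A B G P ς : ℝ} (hε : 0 < ε)
    (hϱ0 : ∀ z, ε ≤ ϱ z) (hϱ1 : ∀ z, ϱ z ≤ K - ε)
    (hδ : ∀ i x, |ϱ (x + Pi.single i 1) - ϱ x| ≤ δ) {p : Fin d → Bool → ℝ}
    (hp : ∀ i b, 0 ≤ p i b) (hP : ∀ i b, p i b ≤ P) (hς : 0 < ς)
    (hpc : ∀ i, ς ≤ p i true ∨ ς ≤ p i false) (hB : 0 < B) {a : Fin d → Site N d → ℝ}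
    (hA0 : 0 < A) (hA : ∀ i x, |a i x| ≤ A)
    (hG : ∀ j, ∑ y : Site N d, boxFlow ℓ j y ^ 2 ≤ G) {f : GCfg N d K → ℝ}
    (hf : ∀ η, 0 ≤ f η) (hf1 : ∑ η, f η * prodBinom ϱ η = 1) :
    ∑ η, (∑ j, ∑ z, (∑ x, flowKernel a ℓ j z x * fluct ϱ x (η x))
        * (fluct ϱ z (η z) - fluct ϱ (z + Pi.single j 1) (η (z + Pi.single j 1))))
        * (f η * prodBinom ϱ η)
      ≤ B * dirichletForm p f (prodBinom ϱ)
        + d * ((K ^ 4 / ε ^ 8 + 1) / (B * ς)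
          * (8 * (K / ε ^ 2) ^ 2 * (d * A * ℓ) ^ 2
              * relEnt (fun η => f η * prodBinom ϱ η) (prodBinom ϱ)
            + 2 * (K / ε ^ 2) ^ 2 * ((d * A) ^ 2 * G) * (N : ℝ) ^ d)
          + B * P * (δ ^ 2 * (K / ε ^ 2) ^ 4) * (N : ℝ) ^ d) := by
  have hN : 1 < N := by omega
  have hν := fun η : GCfg N d K => (prodBinom_pos (fun z => hε.trans_le (hϱ0 z))
    (fun z => by linarith [hϱ1 z]) η).le
  have hne : ∀ (j : Fin d) (z : Site N d), z ≠ z + Pi.single j 1 := fun j z h => by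
    have h1 := congrFun (left_eq_add.1 h) j
    rw [Pi.single_eq_same] at h1
    have h2 : ((1 : Fin N)).val = 1 := by simp [Nat.mod_eq_of_lt hN]
    rw [h1] at h2
    simp at h2
  have hinv : ∀ (j : Fin d) (z u v : Site N d) (η : GCfg N d K), flowKernel a ℓ j z u = 0 →
      flowKernel a ℓ j z v = 0 → ∑ x, flowKernel a ℓ j z x * fluct ϱ x (cfgJump η u v x)
        = ∑ x, flowKernel a ℓ j z x * fluct ϱ x (η x) := by
    intro j z u v η hu hv
    refine Finset.sum_congr rfl fun x _ => ?_
    by_cases hxu : x = u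
    · rw [hxu, hu, zero_mul, zero_mul]
    by_cases hxv : x = v
    · rw [hxv, hv, zero_mul, zero_mul]
    rw [cfgJump_of_ne η hxu hxv]
  have hbond := fun (j : Fin d) (z : Site N d) => sum_mul_fluct_sub_le_rate
    (h := fun η => ∑ x, flowKernel a ℓ j z x * fluct ϱ x (η x)) hK hε hϱ0 hϱ1 (hne j z)
    ((abs_sub_comm _ _).trans_le (hδ j z)) hB hς (hp j true) (hp j false) (hP j true) (hP j false)
    (hpc j) hf hf1
    (fun η => hinv j z _ _ η (flowKernel_self hℓN j z) (flowKernel_add hℓN j z))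
    (fun η => hinv j z _ _ η (flowKernel_add hℓN j z) (flowKernel_self hℓN j z))
  have hcard : ((Fintype.card (Site N d) : ℕ) : ℝ) = (N : ℝ) ^ d := by simp [Site]
  have hlhs : ∑ η, (∑ j, ∑ z, (∑ x, flowKernel a ℓ j z x * fluct ϱ x (η x))
        * (fluct ϱ z (η z) - fluct ϱ (z + Pi.single j 1) (η (z + Pi.single j 1))))
        * (f η * prodBinom ϱ η)
      = ∑ j, ∑ z, ∑ η, (∑ x, flowKernel a ℓ j z x * fluct ϱ x (η x))
        * (fluct ϱ z (η z) - fluct ϱ (z + Pi.single j 1) (η (z + Pi.single j 1)))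
        * (f η * prodBinom ϱ η) := by
    rw [Finset.sum_congr rfl fun η _ => Finset.sum_mul _ _ _, Finset.sum_comm]
    refine Finset.sum_congr rfl fun j _ => ?_
    rw [Finset.sum_congr rfl fun η _ => Finset.sum_mul _ _ _, Finset.sum_comm]
  have hsq := fun j => sum_flow_sq_le (μ := fun η => f η * prodBinom ϱ η) hd hK hℓ (by omega) hε
    hϱ0 hϱ1 hA0 hA j (hG j) (fun η => mul_nonneg (hf η) (hν η)) hf1
  rw [hlhs, dirichletForm_eq, Finset.mul_sum]
  set E := (K ^ 4 / ε ^ 8 + 1) / (B * ς)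
  have hE : 0 ≤ E := by positivity
  calc _ ≤ ∑ j, (B * ∑ z, (p j true * exchangeForm f (prodBinom ϱ) z (z + Pi.single j 1)
          + p j false * exchangeForm f (prodBinom ϱ) (z + Pi.single j 1) z)
        + (E * (8 * (K / ε ^ 2) ^ 2 * (d * A * ℓ) ^ 2
              * relEnt (fun η => f η * prodBinom ϱ η) (prodBinom ϱ)
            + 2 * (K / ε ^ 2) ^ 2 * ((d * A) ^ 2 * G) * (N : ℝ) ^ d)
          + B * P * (δ ^ 2 * (K / ε ^ 2) ^ 4) * (N : ℝ) ^ d)) := by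
        refine Finset.sum_le_sum fun j _ => ?_
        refine (Finset.sum_le_sum fun z _ => hbond j z).trans ?_
        rw [Finset.sum_add_distrib, Finset.sum_add_distrib, ← Finset.mul_sum, ← Finset.mul_sum,
          Finset.sum_const, Finset.card_univ, nsmul_eq_mul, hcard]
        have := mul_le_mul_of_nonneg_left (hsq j) hE
        linarith
    _ = _ := by
        rw [Finset.sum_add_distrib, Finset.sum_const, Finset.card_univ, Fintype.card_fin,
          nsmul_eq_mul]

theorem sum_bond_le {N d K ℓ : ℕ} [NeZero N] (hd : 1 ≤ d) (hK : 1 ≤ K) (hℓ : 1 ≤ ℓ)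
    (hℓN : ℓ + 2 ≤ N) {ϱ : Site N d → ℝ} {ε δ A B G P ς : ℝ} (hε : 0 < ε)
    (hϱ0 : ∀ z, ε ≤ ϱ z) (hϱ1 : ∀ z, ϱ z ≤ K - ε)
    (hδ : ∀ i x, |ϱ (x + Pi.single i 1) - ϱ x| ≤ δ) {p : Fin d → Bool → ℝ}
    (hp : ∀ i b, 0 ≤ p i b) (hP : ∀ i b, p i b ≤ P) (hς : 0 < ς)
    (hpc : ∀ i, ς ≤ p i true ∨ ς ≤ p i false) (hB : 0 < B) {a : Fin d → Site N d → ℝ}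
    (hA0 : 0 < A) (hA : ∀ i x, |a i x| ≤ A)
    (hG : ∀ j, ∑ y : Site N d, boxFlow ℓ j y ^ 2 ≤ G) {μ : GCfg N d K → ℝ}
    (hμ : ∀ η, 0 ≤ μ η) (hμ1 : ∑ η, μ η = 1) :
    ∑ η, (∑ i, ∑ x, a i x * fluct ϱ x (η x)
        * fluct ϱ (x + Pi.single i 1) (η (x + Pi.single i 1))) * μ η
      ≤ B * dirichletForm p (fun η => μ η / prodBinom ϱ η) (prodBinom ϱ)
        + (8 * (K / ε ^ 2) ^ 2 * (d * A) * relEnt μ (prodBinom ϱ)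
          + 2 * (K / ε ^ 2) ^ 2 * (d * A * ((ℓ : ℝ)⁻¹) ^ d) * (N : ℝ) ^ d)
        + d * ((K ^ 4 / ε ^ 8 + 1) / (B * ς)
          * (8 * (K / ε ^ 2) ^ 2 * (d * A * ℓ) ^ 2 * relEnt μ (prodBinom ϱ)
            + 2 * (K / ε ^ 2) ^ 2 * ((d * A) ^ 2 * G) * (N : ℝ) ^ d)
          + B * P * (δ ^ 2 * (K / ε ^ 2) ^ 4) * (N : ℝ) ^ d) := by
  have hν := fun η : GCfg N d K => prodBinom_pos (fun z => hε.trans_le (hϱ0 z))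
    (fun z => by linarith [hϱ1 z]) η
  have hμν : (fun η => μ η / prodBinom ϱ η * prodBinom ϱ η) = μ := by
    funext η
    exact div_mul_cancel₀ _ (hν η).ne'
  have hflow := sum_flow_mul_le hd hK hℓ hℓN hε hϱ0 hϱ1 hδ hp hP hς hpc hB hA0 hA hG
    (f := fun η => μ η / prodBinom ϱ η) (fun η => div_nonneg (hμ η) (hν η).le)
    ((congrArg (fun w => ∑ η, w η) hμν).trans hμ1)
  have hμν' := fun η => congrFun hμν η
  simp only [hμν'] at hflow
  have hs : ∑ y : Site N d, boxWeight ℓ y ≤ 1 := (sum_boxWeight hℓ (by omega)).le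
  have hrow := sum_abs_kernel_row_le (boxWeight_nonneg ℓ) hs hA
  have hcol := sum_abs_kernel_col_le (boxWeight_nonneg ℓ) hs hA
  simp only [mul_one] at hrow hcol
  have hblock := sum_fluct_quadratic_le hK hε hϱ0 hϱ1 (by positivity)
    (abs_blockKernel_le (ℓ := ℓ) hA) hrow hcol (by positivity) hμ hμ1
  have hid : ∀ η : GCfg N d K, (∑ i, ∑ x, a i x * fluct ϱ x (η x)
        * fluct ϱ (x + Pi.single i 1) (η (x + Pi.single i 1)))
      = (∑ x, ∑ y, blockKernel a ℓ x y * (fluct ϱ x (η x) * fluct ϱ y (η y)))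
        + ∑ j, ∑ z, (∑ x, flowKernel a ℓ j z x * fluct ϱ x (η x))
          * (fluct ϱ z (η z) - fluct ϱ (z + Pi.single j 1) (η (z + Pi.single j 1))) := fun η =>
    sum_mul_mul_eq hℓ (by omega) a fun x => fluct ϱ x (η x)
  simp only [hid, add_mul, Finset.sum_add_distrib] at hblock hflow ⊢
  linarith

theorem exists_bounds_of_contDiff_of_periodic {d : ℕ} {ρ : ℝ → (Fin d → ℝ) → ℝ}
    (hρ : ContDiff ℝ (⊤ : ℕ∞) (fun q : ℝ × (Fin d → ℝ) => ρ q.1 q.2))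
    (hper : ∀ (s : ℝ) (u : Fin d → ℝ) (z : Fin d → ℤ), ρ s (fun j => u j + z j) = ρ s u) (T : ℝ) :
    ∃ M L : ℝ, 0 ≤ M ∧ 0 ≤ L ∧ ∀ s ∈ Set.Icc 0 T,
      (∀ u, |ρ s u| ≤ M) ∧ ∀ u v, |ρ s u - ρ s v| ≤ L * ‖u - v‖ := by
  set F : ℝ × (Fin d → ℝ) → ℝ := fun q => ρ q.1 q.2 with hF
  have hcpt : IsCompact (Set.Icc (0 : ℝ) T ×ˢ Set.Icc (0 : Fin d → ℝ) 1) :=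
    isCompact_Icc.prod isCompact_Icc
  have hdiff : Differentiable ℝ F := hρ.differentiable (by simp)
  obtain ⟨M, hM⟩ := hcpt.exists_bound_of_continuousOn hρ.continuous.continuousOn
  obtain ⟨L, hL⟩ := hcpt.exists_bound_of_continuousOn
    (hρ.continuous_fderiv (by simp)).continuousOn
  have hred : ∀ u : Fin d → ℝ, ∃ v ∈ Set.Icc (0 : Fin d → ℝ) 1, ∃ z : Fin d → ℤ,
      u = fun j => v j + z j := fun u =>
    ⟨fun j => Int.fract (u j), ⟨fun j => Int.fract_nonneg _, fun j => (Int.fract_lt_one _).le⟩,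
      fun j => ⌊u j⌋, funext fun j => (Int.fract_add_floor _).symm⟩
  have hfd : ∀ (s : ℝ) (v : Fin d → ℝ) (z : Fin d → ℤ),
      fderiv ℝ F (s, fun j => v j + z j) = fderiv ℝ F (s, v) := fun s v z => by
    have h1 : (fun q => F (q + ((0 : ℝ), fun j => (z j : ℝ)))) = F := by
      funext q
      simp only [hF, Prod.fst_add, Prod.snd_add, add_zero]
      exact hper q.1 q.2 z
    have h2 := fderiv_comp_add_right (𝕜 := ℝ) (f := F) (x := (s, v)) ((0 : ℝ), fun j => (z j : ℝ))
    rw [h1] at h2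
    rw [h2]
    congr 1
    ext <;> simp
  refine ⟨|M|, |L|, abs_nonneg _, abs_nonneg _, fun s hs => ⟨fun u => ?_, fun u v => ?_⟩⟩
  · obtain ⟨v, hv, z, rfl⟩ := hred u
    rw [hper]
    exact (hM (s, v) ⟨hs, hv⟩).trans (le_abs_self M)
  · have hb : ∀ q ∈ Set.Icc (0 : ℝ) T ×ˢ (Set.univ : Set (Fin d → ℝ)), ‖fderiv ℝ F q‖ ≤ |L| := by
      rintro ⟨s', u'⟩ ⟨hs', -⟩
      obtain ⟨v', hv', z, rfl⟩ := hred u'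
      rw [hfd]
      exact (hL (s', v') ⟨hs', hv'⟩).trans (le_abs_self L)
    have h := Convex.norm_image_sub_le_of_norm_fderiv_le (fun q _ => hdiff q) hb
      ((convex_Icc 0 T).prod convex_univ) (x := (s, v)) (y := (s, u)) ⟨hs, trivial⟩ ⟨hs, trivial⟩
    simpa [Prod.norm_def] using h

theorem exists_siteCoord_siteMove {N d : ℕ} (x : Site N d) (i : Fin d) :
    ∃ z : Fin d → ℤ, siteCoord (siteMove x i true)
      = fun j => siteCoord x j + Pi.single (M := fun _ => ℝ) i (1 / (N : ℝ)) j + (z j : ℝ) := by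
  have hN : (N : ℝ) ≠ 0 := by
    have := (x i).isLt
    exact_mod_cast (by omega : N ≠ 0)
  have hlt := (x i).isLt
  rcases Nat.lt_or_ge ((x i).val + 1) N with h | h
  · refine ⟨0, funext fun j => ?_⟩
    by_cases hj : j = i
    · subst hj
      simp [siteCoord, siteMove, finCycAdd, Nat.mod_eq_of_lt h]
      field_simp
    · simp [siteCoord, siteMove, hj]
  · refine ⟨Pi.single i (-1), funext fun j => ?_⟩
    by_cases hj : j = i
    · subst hj
      have h2 : (x j).val + 1 = N := by omega
      have h3 : ((x j).val : ℝ) + 1 = N := by exact_mod_cast h2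
      have h4 : ((x j).val : ℝ) / N + (N : ℝ)⁻¹ = 1 := by
        rw [← one_div, ← add_div, h3, div_self hN]
      simp [siteCoord, siteMove, finCycAdd, h2, h4]
    · simp [siteCoord, siteMove, hj]

theorem abs_profileGE_siteMove_sub_le {d K N : ℕ} {ϱs α κ t L : ℝ} {m : Fin d → ℝ}
    {ρ : ℝ → (Fin d → ℝ) → ℝ}
    (hper : ∀ (s : ℝ) (u : Fin d → ℝ) (z : Fin d → ℤ), ρ s (fun j => u j + z j) = ρ s u)
    (hL : ∀ u v, |ρ ((N : ℝ) ^ (κ - α) * t) u - ρ ((N : ℝ) ^ (κ - α) * t) v| ≤ L * ‖u - v‖)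
    (x : Site N d) (i : Fin d) :
    |profileGE d K ϱs α κ m ρ N t (siteCoord (siteMove x i true))
        - profileGE d K ϱs α κ m ρ N t (siteCoord x)| ≤ (N : ℝ) ^ (-α) * (L * (1 / N)) := by
  obtain ⟨z, hz⟩ := exists_siteCoord_siteMove x i
  unfold profileGE
  rw [hz, add_sub_add_left_eq_sub, ← mul_sub, abs_mul, abs_of_nonneg (by positivity)]
  refine mul_le_mul_of_nonneg_left ?_ (by positivity)
  have h1 : (fun j => siteCoord x j + Pi.single (M := fun _ => ℝ) i (1 / (N : ℝ)) j + (z j : ℝ)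
        - (N : ℝ) ^ κ * ((K : ℝ) - 2 * ϱs) * t * m j)
      = fun j => (siteCoord x j + Pi.single (M := fun _ => ℝ) i (1 / (N : ℝ)) j
        - (N : ℝ) ^ κ * ((K : ℝ) - 2 * ϱs) * t * m j) + (z j : ℝ) := by
    funext j
    ring
  rw [h1, hper]
  refine (hL _ _).trans_eq ?_
  congr 1
  have h2 : (fun j => siteCoord x j + Pi.single (M := fun _ => ℝ) i (1 / (N : ℝ)) j
        - (N : ℝ) ^ κ * ((K : ℝ) - 2 * ϱs) * t * m j)
      - (fun j => siteCoord x j - (N : ℝ) ^ κ * ((K : ℝ) - 2 * ϱs) * t * m j)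
      = Pi.single i (1 / (N : ℝ)) := by
    funext j
    simp only [Pi.sub_apply]
    ring
  rw [h2, Pi.norm_single, Real.norm_of_nonneg (by positivity)]

theorem two_mul_sum_mul_inv_pow_bounds {d ℓ : ℕ} (hd : 1 ≤ d) (hℓ : 1 ≤ ℓ) {g : ℝ}
    (hg : g = if d = 1 then (ℓ : ℝ) else if d = 2 then Real.log ℓ else 1) :
    0 ≤ g ∧ (ℓ : ℝ) ^ 2 ≤ 10 * (1 + (ℓ : ℝ) ^ d * g) ∧ (ℓ : ℝ) ^ d ≤ 10 * (1 + (ℓ : ℝ) ^ d * g) ∧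
      2 * ∑ r ∈ Finset.Ico 1 ℓ, (r : ℝ) * ((r : ℝ)⁻¹) ^ d * (ℓ : ℝ) ^ d
        ≤ 10 * (1 + (ℓ : ℝ) ^ d * g) := by
  have h1 : (1 : ℝ) ≤ ℓ := by exact_mod_cast hℓ
  have hg0 : 0 ≤ g := by
    rw [hg]
    split_ifs
    · positivity
    · exact Real.log_nonneg h1
    · exact zero_le_one
  refine ⟨hg0, ?_⟩
  rcases hℓ.eq_or_lt with rfl | hℓ2
  · have : 0 ≤ g := hg0
    simp only [Nat.cast_one, one_pow, one_mul, Finset.Ico_self, Finset.sum_empty, mul_zero]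
    exact ⟨by linarith, by linarith, by linarith⟩
  have h2 : (2 : ℝ) ≤ ℓ := by exact_mod_cast hℓ2
  have hp : 0 < (ℓ : ℝ) ^ d := by positivity
  suffices h : (ℓ : ℝ) ^ 2 ≤ 10 * ((ℓ : ℝ) ^ d * g) ∧ 1 ≤ 10 * g ∧
      2 * ∑ r ∈ Finset.Ico 1 ℓ, (r : ℝ) * ((r : ℝ)⁻¹) ^ d ≤ 10 * g by
    obtain ⟨e1, e2, e3⟩ := h
    rw [← Finset.sum_mul]
    have e4 := mul_le_mul_of_nonneg_right e2 hp.le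
    have e5 := mul_le_mul_of_nonneg_right e3 hp.le
    exact ⟨by linarith, by linarith, by linarith⟩
  rcases (by omega : d = 1 ∨ d = 2 ∨ 3 ≤ d) with rfl | rfl | hd3
  · simp only [if_true] at hg
    rw [hg]
    refine ⟨by nlinarith, by linarith, ?_⟩
    have : ∑ r ∈ Finset.Ico 1 ℓ, (r : ℝ) * ((r : ℝ)⁻¹) ^ 1 ≤ ∑ r ∈ Finset.Ico 1 ℓ, (1 : ℝ) :=
      Finset.sum_le_sum fun r _ => by
        rw [pow_one]
        exact mul_inv_le_one
    simp only [Finset.sum_const, Nat.card_Ico, nsmul_eq_mul, mul_one, Nat.cast_sub hℓ] at this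
    push_cast at this
    linarith
  · have h3 : (1 : ℝ) / 2 ≤ g := by
      have := Real.log_le_log (by norm_num) h2
      have := Real.log_two_gt_d9
      simp only [if_true, OfNat.ofNat_ne_one, if_false] at hg
      linarith
    refine ⟨by nlinarith, by linarith, ?_⟩
    have h4 : ∑ r ∈ Finset.Ico 1 ℓ, (r : ℝ) * ((r : ℝ)⁻¹) ^ 2 ≤ 1 + Real.log ℓ := by
      have e : ∑ r ∈ Finset.Ico 1 ℓ, (r : ℝ) * ((r : ℝ)⁻¹) ^ 2 = (harmonic (ℓ - 1) : ℝ) := by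
        rw [harmonic, Finset.sum_Ico_eq_sum_range]
        push_cast
        refine Finset.sum_congr rfl fun r _ => ?_
        field_simp
        ring
      rw [e]
      refine (harmonic_le_one_add_log _).trans ?_
      have : Real.log ((ℓ - 1 : ℕ) : ℝ) ≤ Real.log ℓ :=
        Real.log_le_log (by exact_mod_cast (by omega : 0 < ℓ - 1))
          (by exact_mod_cast Nat.sub_le _ _)
      linarith
    simp only [if_true, OfNat.ofNat_ne_one, if_false] at hg
    linarith
  · rw [if_neg (by omega), if_neg (by omega)] at hg
    rw [hg]
    refine ⟨?_, by norm_num, ?_⟩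
    · have := pow_le_pow_right₀ h1 (by omega : 2 ≤ d)
      linarith
    · have h4 : ∑ r ∈ Finset.Ico 1 ℓ, (r : ℝ) * ((r : ℝ)⁻¹) ^ d
          ≤ ∑ r ∈ Finset.Ioo 0 ℓ, ((r : ℝ) ^ 2)⁻¹ := by
        refine Finset.sum_le_sum_of_subset_of_nonneg (fun r hr => ?_) (fun _ _ _ => by positivity)
          |>.trans' (Finset.sum_le_sum fun r hr => ?_)
        · simp only [Finset.mem_Ico, Finset.mem_Ioo] at hr ⊢
          omega
        · have hr1 : (1 : ℝ) ≤ r := by exact_mod_cast (Finset.mem_Ico.1 hr).1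
          have e := pow_le_pow_of_le_one (by positivity) (inv_le_one_of_one_le₀ hr1) hd3
          calc (r : ℝ) * ((r : ℝ)⁻¹) ^ d ≤ r * ((r : ℝ)⁻¹) ^ 3 := by gcongr
            _ = _ := by field_simp
      have h5 := sum_Ioo_inv_sq_le (α := ℝ) 0 ℓ
      norm_num at h5
      linarith

theorem exists_rate_bounds {d : ℕ} (hd : 1 ≤ d) {p : Fin d → Bool → ℝ} (hp : ∀ i b, 0 ≤ p i b)
    (hpd : ∀ i, 0 < p i true + p i false) :
    ∃ ς P : ℝ, 0 < ς ∧ 0 < P ∧ (∀ i b, p i b ≤ P) ∧ ∀ i, ς ≤ p i true ∨ ς ≤ p i false := by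
  have : Nonempty (Fin d) := ⟨⟨0, hd⟩⟩
  obtain ⟨i₀, hi₀⟩ := Finite.exists_min fun i => p i true + p i false
  refine ⟨(p i₀ true + p i₀ false) / 2, ∑ i, ∑ b, p i b + 1, half_pos (hpd i₀), ?_,
    fun i b => ?_, fun i => ?_⟩
  · exact add_pos_of_nonneg_of_pos
      (Finset.sum_nonneg fun i _ => Finset.sum_nonneg fun b _ => hp i b) one_pos
  · have h1 := Finset.single_le_sum (f := fun b => p i b) (fun b _ => hp i b) (Finset.mem_univ b)
    have h2 := Finset.single_le_sum (f := fun i => ∑ b, p i b)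
      (fun i _ => Finset.sum_nonneg fun b _ => hp i b) (Finset.mem_univ i)
    linarith
  · by_contra! h
    have := hi₀ i
    linarith [h.1, h.2]

theorem error_terms_le {D c A A₀ B δ L P ς e n₁ n₂ X l Ld G V Nd H c₀ : ℝ} (hD : 0 ≤ D)
    (hA₀ : 0 ≤ A₀) (hB : 0 < B) (hP : 0 ≤ P) (hς : 0 < ς) (he : 0 ≤ e)
    (hH : 0 ≤ H) (hV : 0 ≤ V) (hA : A = A₀ * n₁) (hAB : A ^ 2 = A₀ ^ 2 * n₂ * B)
    (hBδ : B * δ ^ 2 = L ^ 2 * n₂) (hLd : Ld ≠ 0) (hVN : V * Ld = Nd) (hc₀ : 0 ≤ c₀) (hX0 : 0 ≤ X) (hX : n₁ ≤ X)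
    (h2 : n₂ * l ^ 2 ≤ c₀ * X) (h3 : n₂ * (G * Ld) ≤ c₀ * X) (h4 : n₂ * Ld ≤ c₀ * X) :
    (8 * c ^ 2 * (D * A) * H + 2 * c ^ 2 * (D * A * Ld⁻¹) * Nd)
        + D * (e / (B * ς) * (8 * c ^ 2 * (D * A * l) ^ 2 * H + 2 * c ^ 2 * ((D * A) ^ 2 * G) * Nd)
          + B * P * (δ ^ 2 * c ^ 4) * Nd)
      ≤ (8 * c ^ 2 * D * A₀ + D * (e / ς) * (8 * c ^ 2 * (D * A₀) ^ 2) * c₀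
          + D * P * L ^ 2 * c ^ 4 * c₀) * X * (H + V) := by
  have t1 : 8 * c ^ 2 * (D * A) * H ≤ 8 * c ^ 2 * D * A₀ * (X * H) := by
    rw [hA]
    have : 8 * c ^ 2 * D * A₀ * (n₁ * H) ≤ 8 * c ^ 2 * D * A₀ * (X * H) := by gcongr
    linarith
  have t2 : 2 * c ^ 2 * (D * A * Ld⁻¹) * Nd ≤ 8 * c ^ 2 * D * A₀ * (X * V) := by
    have e1 : 2 * c ^ 2 * (D * A * Ld⁻¹) * Nd = 2 * c ^ 2 * D * A₀ * (n₁ * V) := by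
      rw [hA, ← hVN]
      field_simp
    have e2 : 2 * c ^ 2 * D * A₀ * (n₁ * V) ≤ 2 * c ^ 2 * D * A₀ * (X * V) := by gcongr
    have e3 : 0 ≤ c ^ 2 * D * A₀ * (X * V) := by positivity
    linarith
  have t3 : D * (e / (B * ς) * (8 * c ^ 2 * (D * A * l) ^ 2 * H))
      ≤ D * (e / ς) * (8 * c ^ 2 * (D * A₀) ^ 2) * (c₀ * X * H) := by
    have e1 : D * (e / (B * ς) * (8 * c ^ 2 * (D * A * l) ^ 2 * H))
        = D * (e / ς) * (8 * c ^ 2 * (D * A₀) ^ 2) * (n₂ * l ^ 2 * H) := by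
      rw [mul_pow, mul_pow D A, hAB]
      field_simp
    rw [e1]
    gcongr
  have t4 : D * (e / (B * ς) * (2 * c ^ 2 * ((D * A) ^ 2 * G) * Nd))
      ≤ D * (e / ς) * (8 * c ^ 2 * (D * A₀) ^ 2) * (c₀ * X * V) := by
    have e1 : D * (e / (B * ς) * (2 * c ^ 2 * ((D * A) ^ 2 * G) * Nd))
        = D * (e / ς) * (2 * c ^ 2 * (D * A₀) ^ 2) * (n₂ * (G * Ld) * V) := by
      rw [mul_pow D A, hAB, ← hVN]
      field_simp
    have e2 : D * (e / ς) * (2 * c ^ 2 * (D * A₀) ^ 2) * (n₂ * (G * Ld) * V)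
        ≤ D * (e / ς) * (2 * c ^ 2 * (D * A₀) ^ 2) * (c₀ * X * V) := by gcongr
    have e3 : 0 ≤ D * (e / ς) * (c ^ 2 * (D * A₀) ^ 2) * (c₀ * X * V) := by
      positivity
    linarith
  have t5 : D * (B * P * (δ ^ 2 * c ^ 4) * Nd) ≤ D * P * L ^ 2 * c ^ 4 * (c₀ * X * V) := by
    have e1 : D * (B * P * (δ ^ 2 * c ^ 4) * Nd) = D * P * L ^ 2 * c ^ 4 * (n₂ * Ld * V) := by
      rw [← hVN]
      linear_combination (D * P * c ^ 4 * V * Ld) * hBδ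
    rw [e1]
    gcongr
  have t6 : 0 ≤ D * P * L ^ 2 * c ^ 4 * (c₀ * X * H) := by positivity
  linarith

theorem sum_prodBinom {N d : ℕ} (K : ℕ) (ϱ : Site N d → ℝ) :
    ∑ η : GCfg N d K, prodBinom ϱ η = 1 := by
  have h := Finset.prod_univ_sum (fun _ : Site N d => (Finset.univ : Finset (Fin (K + 1))))
    fun x k => binomW K (ϱ x) k.val
  rw [Fintype.piFinset_univ] at h
  simp only [sum_binomW, Finset.prod_const_one] at h
  exact h.symm

/-- Estimate for the main term `R_{N,t}` in the relative entropy computation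
(Proposition `prop:bg`): with `a^N_{i,x} = N^{1+κ} b_N(x,x+e_i)(ϱ_{x+e_i} − ϱ_x)` and
`g_d(ℓ) = ℓ, log ℓ, 1` in dimensions `1, 2, ≥3`, there is a constant `C` (independent
of `N`, `ℓ` and `t ∈ [0,T]`) such that for all large `N` and all `1 ≤ ℓ` with `6ℓ ≤ N`,
`R_{N,t} ≤ N^{1+κ} D_N(f_{N,t};ν_{N,t})
  + C[N^{κ−α} + N^{κ−2α−1} ℓ^d g_d(ℓ)][H_N(t) + N^d/ℓ^d]
  + C[H_N(t) + N^{d+2κ−4α−2} ℓ^d g_d(ℓ)]`. -/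
theorem statement3 (d K : ℕ) (hd : 1 ≤ d) (hK : 1 ≤ K)
    (p : Fin d → Bool → ℝ) (hp : ∀ i b, 0 ≤ p i b)
    (hpd : ∀ i, 0 < p i true + p i false)
    (hm : (fun i => p i true - p i false) ≠ (0 : Fin d → ℝ))
    (ϱs : ℝ) (hϱs : ϱs ∈ Set.Ioo (0 : ℝ) (K : ℝ))
    (α κ T : ℝ) (hα : 0 < α) (hκ : 0 < κ) (hκα : κ ≤ α) (hT : 0 < T)
    (ρ : ℝ → (Fin d → ℝ) → ℝ)
    (hρsmooth : ContDiff ℝ (⊤ : ℕ∞) (fun q : ℝ × (Fin d → ℝ) => ρ q.1 q.2))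
    (hρper : ∀ (s : ℝ) (u : Fin d → ℝ) (z : Fin d → ℤ),
      ρ s (fun j => u j + z j) = ρ s u)
    (hρpde : ∀ s ∈ Set.Icc (0 : ℝ) T, ∀ u : Fin d → ℝ,
      deriv (fun s' => ρ s' u) s
        = ∑ i, (p i true - p i false)
            * deriv (fun h => ρ s (Function.update u i h) ^ 2) (u i))
    (μ : (N : ℕ) → ℝ → GCfg N d K → ℝ)
    (hμprob : ∀ (N : ℕ) (t : ℝ), 0 ≤ t → (∀ η, 0 ≤ μ N t η) ∧ ∑ η, μ N t η = 1)
    (hkolm : ∀ (N : ℕ), 1 ≤ N → ∀ (f : GCfg N d K → ℝ) (t : ℝ), 0 ≤ t →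
      HasDerivAt (fun s => ∑ η, f η * μ N s η)
        ((N : ℝ) ^ ((1 : ℝ) + κ) * ∑ η, genL p f η * μ N t η) t) :
    let ϱ : (N : ℕ) → ℝ → Site N d → ℝ := fun N t x =>
      profileGE d K ϱs α κ (fun i => p i true - p i false) ρ N t (siteCoord x)
    let ω : (N : ℕ) → ℝ → Site N d → GCfg N d K → ℝ := fun N t x η =>
      (((η x).val : ℝ) - ϱ N t x) / (ϱ N t x * ((K : ℝ) - ϱ N t x))
    let bN : (N : ℕ) → ℝ → Fin d → Site N d → ℝ := fun N t i x =>
      (K : ℝ) * (p i true * ϱ N t x * ((K : ℝ) - ϱ N t (siteMove x i true))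
        - p i false * ϱ N t (siteMove x i true) * ((K : ℝ) - ϱ N t x))
    let aN : (N : ℕ) → ℝ → Fin d → Site N d → ℝ := fun N t i x =>
      (N : ℝ) ^ ((1 : ℝ) + κ) * bN N t i x * (ϱ N t (siteMove x i true) - ϱ N t x)
    let HN : ℕ → ℝ → ℝ := fun N t => relEnt (μ N t) (prodBinom (ϱ N t))
    let R : ℕ → ℝ → ℝ := fun N t =>
      ∑ η : GCfg N d K,
        (∑ i : Fin d, ∑ x : Site N d,
            aN N t i x * ω N t x η * ω N t (siteMove x i true) η) * μ N t η
    let gd : ℕ → ℝ := fun ℓ => if d = 1 then (ℓ : ℝ) else if d = 2 then Real.log ℓ else 1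
    ∃ C : ℝ, ∃ N₀ : ℕ, ∀ N : ℕ, N₀ ≤ N → ∀ ℓ : ℕ, 1 ≤ ℓ → 6 * ℓ ≤ N →
      ∀ t ∈ Set.Icc (0 : ℝ) T,
        R N t ≤ (N : ℝ) ^ ((1 : ℝ) + κ)
            * dirichletForm p (fun η => μ N t η / prodBinom (ϱ N t) η) (prodBinom (ϱ N t))
          + C * ((N : ℝ) ^ (κ - α) + (N : ℝ) ^ (κ - 2 * α - 1) * (ℓ : ℝ) ^ d * gd ℓ)
            * (HN N t + (N : ℝ) ^ d / (ℓ : ℝ) ^ d)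
          + C * (HN N t + (N : ℝ) ^ ((d : ℝ) + 2 * κ - 4 * α - 2) * (ℓ : ℝ) ^ d * gd ℓ) := by
  intro ϱ ω bN aN HN R gd
  obtain ⟨M, L, hM0, hL0, hρb⟩ := exists_bounds_of_contDiff_of_periodic hρsmooth hρper T
  obtain ⟨ς, P, hς, hP0, hP, hpς⟩ := exists_rate_bounds hd hp hpd
  have hK0 : (0 : ℝ) < K := by positivity
  obtain ⟨ε, hε, hε0, hε1⟩ : ∃ ε : ℝ, 0 < ε ∧ 2 * ε ≤ ϱs ∧ 2 * ε ≤ K - ϱs :=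
    ⟨min ϱs (K - ϱs) / 2, half_pos (lt_min hϱs.1 (sub_pos.2 hϱs.2)),
      by linarith [min_le_left ϱs (K - ϱs)], by linarith [min_le_right ϱs (K - ϱs)]⟩
  have hsmall : ∀ᶠ N : ℕ in atTop, (N : ℝ) ^ (-α) * M ≤ ε := by
    have h := ((tendsto_rpow_neg_atTop hα).comp tendsto_natCast_atTop_atTop).mul_const M
    rw [zero_mul] at h
    exact (h.eventually (gt_mem_nhds hε)).mono fun N hN => le_of_lt hN
  obtain ⟨N₀, hN₀⟩ := eventually_atTop.1 hsmall
  set A₀ : ℝ := K ^ 3 * P * (L + 1) with hA₀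
  have hA₀pos : 0 < A₀ := by positivity
  set C : ℝ := 8 * (K / ε ^ 2) ^ 2 * d * A₀
    + d * ((K ^ 4 / ε ^ 8 + 1) / ς) * (8 * (K / ε ^ 2) ^ 2 * (d * A₀) ^ 2) * 10
    + d * P * (L + 1) ^ 2 * (K / ε ^ 2) ^ 4 * 10 with hC
  have hC0 : 0 ≤ C := by positivity
  refine ⟨C, N₀, fun N hN ℓ hℓ hℓN t ht => ?_⟩
  have hN1 : 1 ≤ N := by omega
  have : NeZero N := ⟨by omega⟩
  have hN1' : (1 : ℝ) ≤ N := by exact_mod_cast hN1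
  have hN0' : (0 : ℝ) < N := by positivity
  have hℓ0 : (0 : ℝ) < ℓ := by positivity
  have hs : (N : ℝ) ^ (κ - α) * t ∈ Set.Icc 0 T :=
    ⟨mul_nonneg (by positivity) ht.1, (mul_le_of_le_one_left ht.1
      (Real.rpow_le_one_of_one_le_of_nonpos hN1' (by linarith))).trans ht.2⟩
  obtain ⟨hρM, hρL⟩ := hρb _ hs
  have hϱb : ∀ x, |ϱ N t x - ϱs| ≤ ε := fun x => by
    simp only [ϱ, profileGE, add_sub_cancel_left]
    rw [abs_mul, abs_of_nonneg (by positivity)]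
    exact (mul_le_mul_of_nonneg_left (hρM _) (by positivity)).trans (hN₀ N hN)
  have hϱ0 : ∀ x, ε ≤ ϱ N t x := fun x => by linarith [(abs_le.1 (hϱb x)).1]
  have hϱ1 : ∀ x, ϱ N t x ≤ K - ε := fun x => by linarith [(abs_le.1 (hϱb x)).2]
  set δ : ℝ := (N : ℝ) ^ (-α) * ((L + 1) * (1 / N)) with hδ
  have hδ0 : 0 ≤ δ := by positivity
  have hgrad : ∀ i x, |ϱ N t (siteMove x i true) - ϱ N t x| ≤ δ := fun i x =>
    abs_profileGE_siteMove_sub_le hρper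
      (fun u v => (hρL u v).trans (by gcongr; linarith)) x i
  set B : ℝ := (N : ℝ) ^ ((1 : ℝ) + κ) with hB
  have hB0 : 0 < B := by positivity
  have hNinv : (1 : ℝ) / N = (N : ℝ) ^ (-1 : ℝ) := by rw [Real.rpow_neg_one, one_div]
  have hBδ1 : B * δ = (L + 1) * (N : ℝ) ^ (κ - α) := by
    have : (N : ℝ) ^ ((1 : ℝ) + κ) * ((N : ℝ) ^ (-α) * (N : ℝ) ^ (-1 : ℝ)) = (N : ℝ) ^ (κ - α) := by
      rw [← Real.rpow_add hN0', ← Real.rpow_add hN0']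
      congr 1
      ring
    rw [hB, hδ, hNinv, ← this]
    ring
  have hδeq : δ = (L + 1) * (N : ℝ) ^ (-α - 1) := by
    have : (N : ℝ) ^ (-α) * (N : ℝ) ^ (-1 : ℝ) = (N : ℝ) ^ (-α - 1) := by
      rw [← Real.rpow_add hN0']
      congr 1
    rw [hδ, hNinv, ← this]
    ring
  have hn : (N : ℝ) ^ (κ - α) * (N : ℝ) ^ (-α - 1) = (N : ℝ) ^ (κ - 2 * α - 1) := by
    rw [← Real.rpow_add hN0']
    congr 1
    ring
  have hBδ2 : B * δ ^ 2 = (L + 1) ^ 2 * (N : ℝ) ^ (κ - 2 * α - 1) := by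
    rw [sq, ← mul_assoc, hBδ1, hδeq, ← hn]
    ring
  have hAB : (A₀ * (N : ℝ) ^ (κ - α)) ^ 2 = A₀ ^ 2 * (N : ℝ) ^ (κ - 2 * α - 1) * B := by
    have : ((N : ℝ) ^ (κ - α)) ^ 2 = (N : ℝ) ^ (κ - 2 * α - 1) * B := by
      rw [sq, hB, ← Real.rpow_add hN0', ← Real.rpow_add hN0']
      congr 1
      ring
    rw [mul_pow, this, mul_assoc]
  have hb : ∀ i x, |bN N t i x| ≤ K ^ 3 * P := by
    have hterm : ∀ i b x y, 0 ≤ p i b * ϱ N t x * ((K : ℝ) - ϱ N t y) ∧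
        p i b * ϱ N t x * ((K : ℝ) - ϱ N t y) ≤ P * K * K := fun i b x y => by
      have h1 := hϱ0 x
      have h2 := hϱ1 x
      have h3 := hϱ0 y
      have h4 := hϱ1 y
      have h5 := hp i b
      exact ⟨mul_nonneg (mul_nonneg h5 (by linarith)) (by linarith),
        mul_le_mul (mul_le_mul (hP i b) (by linarith) (by linarith) hP0.le) (by linarith)
          (by linarith) (by positivity)⟩
    intro i x
    simp only [bN]
    rw [abs_mul, abs_of_pos hK0]
    have h1 := hterm i true x (siteMove x i true)
    have h2 := hterm i false (siteMove x i true) x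
    calc _ ≤ K * (P * K * K) :=
          mul_le_mul_of_nonneg_left (abs_sub_le_of_nonneg_of_le h1.1 h1.2 h2.1 h2.2) hK0.le
      _ = _ := by ring
  have ha : ∀ i x, |aN N t i x| ≤ A₀ * (N : ℝ) ^ (κ - α) := fun i x => by
    simp only [aN]
    rw [abs_mul, abs_mul, abs_of_pos hB0]
    calc _ ≤ B * (K ^ 3 * P) * δ := by
          gcongr
          · exact hb i x
          · exact hgrad i x
      _ = K ^ 3 * P * (B * δ) := by ring
      _ = _ := by rw [hBδ1, hA₀]; ring
  obtain ⟨hg0, hg1, hg2, hg3⟩ := two_mul_sum_mul_inv_pow_bounds hd hℓ (g := gd ℓ) rfl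
  obtain ⟨hμ0, hμ1⟩ := hμprob N t ht.1
  have hmain := sum_bond_le (ϱ := ϱ N t) (a := aN N t) hd hK hℓ (by omega) hε hϱ0 hϱ1
    (fun i x => by rw [← siteMove_true]; exact hgrad i x) hp hP hς hpς hB0
    (by positivity) ha (fun j => sum_boxFlow_sq_le hℓ (by omega) j) hμ0 hμ1
  have hH0 : 0 ≤ HN N t := relEnt_nonneg _ _ hμ0 hμ1
    (prodBinom_pos (fun z => hε.trans_le (hϱ0 z)) fun z => by linarith [hϱ1 z]) (sum_prodBinom K _)
  set n₁ := (N : ℝ) ^ (κ - α)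
  set n₂ := (N : ℝ) ^ (κ - 2 * α - 1)
  have hn₂ : 0 ≤ n₂ := by positivity
  have hn₁₂ : n₂ ≤ n₁ := Real.rpow_le_rpow_of_exponent_le hN1' (by linarith)
  set W := (ℓ : ℝ) ^ d * gd ℓ with hW
  have hW0 : 0 ≤ W := by positivity
  have hX : n₂ * (10 * (1 + W)) ≤ 10 * (n₁ + n₂ * W) := by linarith
  have herr := error_terms_le (D := d) (c := K / ε ^ 2) (A₀ := A₀) (P := P) (ς := ς)
    (e := K ^ 4 / ε ^ 8 + 1) (l := ℓ) (Ld := (ℓ : ℝ) ^ d)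
    (G := 2 * ∑ r ∈ Finset.Ico 1 ℓ, (r : ℝ) * ((r : ℝ)⁻¹) ^ d) (V := (N : ℝ) ^ d / (ℓ : ℝ) ^ d)
    (Nd := (N : ℝ) ^ d) (H := HN N t) (c₀ := 10) (X := n₁ + n₂ * W)
    (Nat.cast_nonneg d) hA₀pos.le hB0 hP0.le hς (by positivity) hH0 (by positivity) rfl hAB hBδ2
    (by positivity) (div_mul_cancel₀ _ (by positivity)) (by norm_num) (by positivity)
    (le_add_of_nonneg_right (by positivity))
    ((mul_le_mul_of_nonneg_left hg1 hn₂).trans hX)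
    ((mul_le_mul_of_nonneg_left (by rw [mul_assoc, Finset.sum_mul]; exact hg3) hn₂).trans hX)
    ((mul_le_mul_of_nonneg_left hg2 hn₂).trans hX)
  have hR : R N t = ∑ η, (∑ i, ∑ x, aN N t i x * fluct (ϱ N t) x (η x)
      * fluct (ϱ N t) (x + Pi.single i 1) (η (x + Pi.single i 1))) * μ N t η := by
    simp only [R, ← siteMove_true]
    rfl
  have hlast : 0 ≤ C * (HN N t + (N : ℝ) ^ ((d : ℝ) + 2 * κ - 4 * α - 2) * (ℓ : ℝ) ^ d * gd ℓ) := by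
    positivity
  rw [hR, mul_assoc n₂]
  rw [inv_pow] at hmain
  linarith
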